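/- arXiv:0906.3113 — 3 statements merged into one kernel-verified Lean document; each statement's English description precedes it below -/
import Mathlib

section
/- Let λ > 0 and define u : {(x,y) ∈ ℝ² : y ≥ 0} → ℝ by u(x,y) = e^{−λy}·sin(λx + π/8) − (√2/(2π))·∫₀^∞ ((t·cos(tλy) − sin(tλy))/(1+t²))·e^{−η(t)}·e^{−tλx} dt for x ≥ 0, y ≥ 0, and u(x,y) = (√2/(2π))·∫₀^∞ (sin(tλy)/(1+t²))·e^{η(t)}·e^{tλx} dt for x ≤ 0, y ≥ 0. Then: (i) the two formulas agree when x = 0, so u is well defined; (ii) u is bounded and continuous on the closed upper half-plane {y ≥ 0}; (iii) u is harmonic in the open upper half-plane, i.e. ∂²u/∂x² + ∂²u/∂y² = 0 for y > 0; (iv) u(x,0) = 0 for every x ≤ 0; (v) for every x > 0, the one-sided derivative lim_{y→0⁺} (u(x,y) − u(x,0))/y exists and equals −λ·u(x,0). (Thus u solves the mixed Steklov problem in the half-plane with spectral parameter λ and Dirichlet condition on (−∞,0].) -/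
open Real MeasureTheory Set Filter Topology

/-- `η t = (1/4)·log(1+t²) − (1/π)·∫₀^t log|s|/(1+s²) ds`. -/
noncomputable def etaF (t : ℝ) : ℝ :=
  Real.log (1 + t ^ 2) / 4 - (1 / Real.pi) * ∫ s in (0 : ℝ)..t, Real.log |s| / (1 + s ^ 2)

/-- The formula for `u` on the quadrant `x ≥ 0`, `y ≥ 0`. -/
noncomputable def uPlus (lam x y : ℝ) : ℝ :=
  Real.exp (-lam * y) * Real.sin (lam * x + Real.pi / 8)
    - (Real.sqrt 2 / (2 * Real.pi)) *
        ∫ t in Ioi (0 : ℝ),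
          ((t * Real.cos (t * lam * y) - Real.sin (t * lam * y)) / (1 + t ^ 2))
            * Real.exp (-etaF t) * Real.exp (-t * lam * x)

/-- The formula for `u` on the quadrant `x ≤ 0`, `y ≥ 0`. -/
noncomputable def uMinus (lam x y : ℝ) : ℝ :=
  (Real.sqrt 2 / (2 * Real.pi)) *
    ∫ t in Ioi (0 : ℝ),
      (Real.sin (t * lam * y) / (1 + t ^ 2)) * Real.exp (etaF t) * Real.exp (t * lam * x)

/-- The solution `u` of the mixed Steklov problem in the half-plane. -/
noncomputable def uSol (lam x y : ℝ) : ℝ :=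
  if 0 ≤ x then uPlus lam x y else uMinus lam x y

lemma one_add_rpow_half_le {x : ℝ} (hx : 2 ≤ x) :
    (1 + x) ^ (1 / 2 : ℝ) ≤ 2 * x ^ (1 / 2 : ℝ) := by
  calc (1 + x) ^ (1 / 2 : ℝ) ≤ (2 ^ 2 * x) ^ (1 / 2 : ℝ) := by
        apply Real.rpow_le_rpow <;> linarith
    _ = 2 * x ^ (1 / 2 : ℝ) := by
        rw [Real.mul_rpow (by norm_num) (by linarith), ← Real.sqrt_eq_rpow,
          Real.sqrt_sq (by norm_num)]

lemma rpow_neg_three_halves {x : ℝ} (hx : 0 < x) :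
    x ^ (-3 / 2 : ℝ) = x ^ (1 / 2 : ℝ) * (x ^ 2)⁻¹ := by
  rw [← Real.rpow_natCast, ← Real.rpow_neg hx.le, ← Real.rpow_add hx]
  norm_num

/-- A function continuous on `[0, ∞)` and of order `x ^ (-3/2)` at infinity is integrable. -/
lemma integrableOn_Ioi_of_norm_le_rpow {E : Type*} [NormedAddCommGroup E] {f : ℝ → E}
    (hc : ContinuousOn f (Ici 0)) {C : ℝ}
    (h : ∀ x : ℝ, 2 ≤ x → ‖f x‖ ≤ C * x ^ (-3 / 2 : ℝ)) : IntegrableOn f (Ioi 0) := by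
  refine IntegrableOn.mono_set ?_ Ioi_subset_Ici_self
  refine (hc.locallyIntegrableOn measurableSet_Ici).integrableOn_of_isBigO_atTop
    (g := fun x : ℝ => x ^ (-3 / 2 : ℝ)) (Asymptotics.IsBigO.of_bound C ?_) ?_
  · filter_upwards [eventually_ge_atTop 2] with x hx
    rw [Real.norm_of_nonneg (by positivity : 0 ≤ x ^ (-3 / 2 : ℝ))]
    exact h x hx
  · exact ⟨Ioi 1, Ioi_mem_atTop 1, integrableOn_Ioi_rpow_of_lt (by norm_num) one_pos⟩

lemma integrableOn_inv_one_add_sq : IntegrableOn (fun s : ℝ => (1 + s ^ 2)⁻¹) (Ioi 0) :=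
  integrable_inv_one_add_sq.integrableOn

lemma integrableOn_log_one_add : IntegrableOn (fun s : ℝ => Real.log (1 + s) * (1 + s ^ 2)⁻¹)
    (Ioi 0) := by
  refine integrableOn_Ioi_of_norm_le_rpow (C := 4) ?_ ?_
  · refine ContinuousOn.mul (ContinuousOn.log (by fun_prop) ?_) (ContinuousOn.inv₀ (by fun_prop) ?_)
    · intro x hx
      have : 0 ≤ x := hx
      positivity
    · intro x _
      positivity
  · intro x hx
    have hx0 : 0 < x := by linarith
    have h0 : 0 ≤ Real.log (1 + x) := Real.log_nonneg (by linarith)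
    have h1 : Real.log (1 + x) ≤ (1 + x) ^ (1 / 2 : ℝ) / (1 / 2) :=
      Real.log_le_rpow_div (by linarith) (by norm_num)
    have h2 := one_add_rpow_half_le hx
    rw [Real.norm_of_nonneg (by positivity)]
    have h4 : (1 + x ^ 2)⁻¹ ≤ (x ^ 2)⁻¹ := inv_anti₀ (by positivity) (by linarith)
    rw [rpow_neg_three_halves hx0, ← mul_assoc]
    have : 0 < x ^ (1 / 2 : ℝ) := by positivity
    gcongr
    linarith

/-- The majorant of the integrand of `etaC` on the right half of the disc of radius `R`. -/
lemma integrableOn_log_majorant (R : ℝ) : IntegrableOn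
    (fun s : ℝ => (Real.log (1 + R) + Real.log (1 + s) + π) * (1 + s ^ 2)⁻¹) (Ioi 0) := by
  have h := (integrableOn_inv_one_add_sq.const_mul (Real.log (1 + R) + π)).add
    integrableOn_log_one_add
  refine h.congr (Eventually.of_forall fun s => ?_)
  simp only [Pi.add_apply]
  ring

lemma one_le_norm_one_add_mul {z : ℂ} (hz : 0 ≤ z.re) {s : ℝ} (hs : 0 ≤ s) :
    1 ≤ ‖1 + z * s‖ := by
  refine le_trans ?_ ((le_abs_self _).trans (Complex.abs_re_le_norm _))
  simp
  positivity

lemma norm_one_add_mul_le (z : ℂ) {s : ℝ} (hs : 0 ≤ s) : ‖1 + z * s‖ ≤ 1 + ‖z‖ * s := by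
  refine (norm_add_le _ _).trans ?_
  simp [abs_of_nonneg hs]

lemma norm_log_one_add_mul_le {z : ℂ} (hz : 0 ≤ z.re) {R : ℝ} (hR : ‖z‖ ≤ R) {s : ℝ}
    (hs : 0 ≤ s) :
    ‖Complex.log (1 + z * s)‖ ≤ Real.log (1 + R) + Real.log (1 + s) + π := by
  have h1 := one_le_norm_one_add_mul hz hs
  have hR0 : 0 ≤ R := (norm_nonneg z).trans hR
  refine (Complex.norm_le_abs_re_add_abs_im _).trans (add_le_add ?_ ?_)
  · rw [Complex.log_re, abs_of_nonneg (Real.log_nonneg h1),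
      ← Real.log_mul (by positivity) (by positivity)]
    refine Real.log_le_log (by linarith) ((norm_one_add_mul_le z hs).trans ?_)
    nlinarith [mul_le_mul_of_nonneg_right hR hs]
  · rw [Complex.log_im]
    exact Complex.abs_arg_le_pi _

/-- The holomorphic extension `η(z) = (1/π)·∫₀^∞ log(1+zs)/(1+s²) ds` of `etaF`. -/
noncomputable def etaC (z : ℂ) : ℂ :=
  (1 / π : ℂ) * ∫ s in Ioi (0 : ℝ), Complex.log (1 + z * s) * (((1 + s ^ 2)⁻¹ : ℝ) : ℂ)

lemma aestronglyMeasurable_etaC (z : ℂ) : AEStronglyMeasurable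
    (fun s : ℝ => Complex.log (1 + z * s) * (((1 + s ^ 2)⁻¹ : ℝ) : ℂ))
    (volume.restrict (Ioi 0)) := by
  have : Measurable fun s : ℝ => Complex.log (1 + z * s) * (((1 + s ^ 2)⁻¹ : ℝ) : ℂ) := by
    fun_prop
  exact this.aestronglyMeasurable

lemma norm_etaC_integrand_le {z : ℂ} (hz : 0 ≤ z.re) {R : ℝ} (hR : ‖z‖ ≤ R) {s : ℝ}
    (hs : 0 ≤ s) : ‖Complex.log (1 + z * s) * (((1 + s ^ 2)⁻¹ : ℝ) : ℂ)‖ ≤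
      (Real.log (1 + R) + Real.log (1 + s) + π) * (1 + s ^ 2)⁻¹ := by
  rw [norm_mul, Complex.norm_real, Real.norm_of_nonneg (by positivity : 0 ≤ (1 + s ^ 2)⁻¹)]
  gcongr
  exact norm_log_one_add_mul_le hz hR hs

lemma integrableOn_etaC {z : ℂ} (hz : 0 ≤ z.re) : IntegrableOn
    (fun s : ℝ => Complex.log (1 + z * s) * (((1 + s ^ 2)⁻¹ : ℝ) : ℂ)) (Ioi 0) := by
  refine (integrableOn_log_majorant ‖z‖).mono' (aestronglyMeasurable_etaC z) ?_
  filter_upwards [ae_restrict_mem measurableSet_Ioi] with s hs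
  exact norm_etaC_integrand_le hz le_rfl (le_of_lt hs)

lemma continuousOn_etaC : ContinuousOn etaC {z | 0 ≤ z.re} := by
  intro z₀ _
  refine ContinuousWithinAt.mul continuousWithinAt_const ?_
  refine continuousWithinAt_of_dominated (Eventually.of_forall aestronglyMeasurable_etaC) ?_
    (integrableOn_log_majorant (‖z₀‖ + 1)) ?_
  · filter_upwards [self_mem_nhdsWithin,
      mem_nhdsWithin_of_mem_nhds (Metric.ball_mem_nhds z₀ one_pos)]
      with z hz hz1
    filter_upwards [ae_restrict_mem measurableSet_Ioi] with s hs
    refine norm_etaC_integrand_le hz ?_ (le_of_lt hs)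
    rw [mem_ball_iff_norm] at hz1
    linarith [norm_le_norm_add_norm_sub z₀ z, norm_sub_rev z₀ z]
  · filter_upwards [ae_restrict_mem measurableSet_Ioi] with s hs
    have hs : 0 < s := hs
    refine ContinuousWithinAt.mul (ContinuousWithinAt.clog (by fun_prop) ?_)
      continuousWithinAt_const
    left
    simp
    have : 0 ≤ z₀.re := by assumption
    positivity

lemma differentiableAt_etaC {z₀ : ℂ} (hz₀ : 0 ≤ z₀.re) (hz₀' : 0 < z₀.im) :
    DifferentiableAt ℂ etaC z₀ := by
  refine DifferentiableAt.const_mul ?_ _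
  have hopen : {z : ℂ | z₀.im / 2 < z.im} ∈ 𝓝 z₀ :=
    (isOpen_lt continuous_const Complex.continuous_im).mem_nhds (half_lt_self hz₀')
  refine (hasDerivAt_integral_of_dominated_loc_of_deriv_le hopen
    (F' := fun z s => s / (1 + z * s) * (((1 + s ^ 2)⁻¹ : ℝ) : ℂ))
    (bound := fun s => (z₀.im / 2)⁻¹ * (1 + s ^ 2)⁻¹)
    (Eventually.of_forall aestronglyMeasurable_etaC) (integrableOn_etaC hz₀) ?_ ?_
    (integrableOn_inv_one_add_sq.const_mul _) ?_).2.differentiableAt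
  · have : Measurable fun s : ℝ => (s : ℂ) / (1 + z₀ * s) * (((1 + s ^ 2)⁻¹ : ℝ) : ℂ) := by
      fun_prop
    exact this.aestronglyMeasurable
  · filter_upwards [ae_restrict_mem measurableSet_Ioi] with s hs z hz
    have hs : 0 < s := hs
    have hz : z₀.im / 2 < z.im := hz
    have h1 : s * (z₀.im / 2) ≤ ‖1 + z * s‖ := by
      refine le_trans ?_ ((le_abs_self _).trans (Complex.abs_im_le_norm _))
      simp
      nlinarith
    rw [norm_mul, norm_div, Complex.norm_real, Complex.norm_real, Real.norm_of_nonneg hs.le,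
      Real.norm_of_nonneg (by positivity : 0 ≤ (1 + s ^ 2)⁻¹)]
    gcongr
    rw [div_le_iff₀ (lt_of_lt_of_le (by positivity) h1), ← div_eq_inv_mul,
      le_div_iff₀ (by positivity)]
    exact h1
  · filter_upwards [ae_restrict_mem measurableSet_Ioi] with s hs z hz
    have hs : 0 < s := hs
    have hz : z₀.im / 2 < z.im := hz
    refine HasDerivAt.mul_const ?_ _
    have h1 : HasDerivAt (fun z : ℂ => 1 + z * s) s z := by
      simpa using ((hasDerivAt_id z).mul_const (s : ℂ)).const_add 1
    refine h1.clog ?_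
    right
    simp
    exact ⟨by linarith, hs.ne'⟩

lemma etaC_re (z : ℂ) (hz : 0 ≤ z.re) :
    (etaC z).re = (1 / π) * ∫ s in Ioi (0 : ℝ), Real.log ‖1 + z * s‖ * (1 + s ^ 2)⁻¹ := by
  have h := integral_re (𝕜 := ℂ) (integrableOn_etaC hz)
  rw [etaC, show (1 / π : ℂ) = ((1 / π : ℝ) : ℂ) by push_cast; rfl, Complex.re_ofReal_mul]
  congr 1
  refine h.symm.trans (integral_congr_ae (Eventually.of_forall fun s => ?_))
  simp [Complex.log_re, -Complex.ofReal_inv]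

lemma etaC_im (z : ℂ) (hz : 0 ≤ z.re) :
    (etaC z).im = (1 / π) * ∫ s in Ioi (0 : ℝ), Complex.arg (1 + z * s) * (1 + s ^ 2)⁻¹ := by
  have h := integral_im (𝕜 := ℂ) (integrableOn_etaC hz)
  rw [etaC, show (1 / π : ℂ) = ((1 / π : ℝ) : ℂ) by push_cast; rfl, Complex.im_ofReal_mul]
  congr 1
  refine h.symm.trans (integral_congr_ae (Eventually.of_forall fun s => ?_))
  simp [Complex.log_im, -Complex.ofReal_inv]

lemma integrableOn_log_norm {z : ℂ} (hz : 0 ≤ z.re) :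
    IntegrableOn (fun s : ℝ => Real.log ‖1 + z * s‖ * (1 + s ^ 2)⁻¹) (Ioi 0) := by
  have h : Integrable _ _ := (integrableOn_etaC hz).re
  refine h.congr (Eventually.of_forall fun s => ?_)
  simp [Complex.log_re, -Complex.ofReal_inv]

lemma log_norm_one_add_I_mul (r s : ℝ) :
    Real.log ‖1 + (r * Complex.I) * (s : ℂ)‖ = 1 / 2 * Real.log (1 + r ^ 2 * s ^ 2) := by
  rw [show 1 + (r * Complex.I) * (s : ℂ) = ((1 : ℝ) : ℂ) + ((r * s : ℝ) : ℂ) * Complex.I by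
    push_cast; ring, Complex.norm_add_mul_I, Real.log_sqrt (by positivity)]
  ring_nf

lemma integrableOn_log_one_add_sq (r : ℝ) :
    IntegrableOn (fun s : ℝ => Real.log (1 + r ^ 2 * s ^ 2) * (1 + s ^ 2)⁻¹) (Ioi 0) := by
  have h : Integrable _ _ := (integrableOn_log_norm (z := r * Complex.I) (by simp)).const_mul 2
  refine h.congr (Eventually.of_forall fun s => ?_)
  simp only [log_norm_one_add_I_mul]
  ring

lemma etaC_I_re (r : ℝ) : (etaC (r * Complex.I)).re =
    (1 / (2 * π)) * ∫ s in Ioi (0 : ℝ), Real.log (1 + r ^ 2 * s ^ 2) * (1 + s ^ 2)⁻¹ := by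
  rw [etaC_re _ (by simp)]
  simp_rw [log_norm_one_add_I_mul, mul_assoc]
  rw [integral_const_mul, ← mul_assoc]
  congr 1
  field_simp

lemma tendsto_arctan_mul {r : ℝ} (hr : 0 < r) :
    Tendsto (fun s => Real.arctan (r * s)) atTop (𝓝 (π / 2)) :=
  (Real.tendsto_arctan_atTop.mono_right nhdsWithin_le_nhds).comp
    (tendsto_id.const_mul_atTop hr)

lemma hasDerivAt_integral_log_one_add_sq {r : ℝ} (hr : 0 < r) (hr1 : r ≠ 1) :
    HasDerivAt (fun r : ℝ => ∫ s in Ioi (0 : ℝ), Real.log (1 + r ^ 2 * s ^ 2) * (1 + s ^ 2)⁻¹)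
      (π / (1 + r)) r := by
  have hval : ∫ s in Ioi (0 : ℝ), 2 * r * s ^ 2 / (1 + r ^ 2 * s ^ 2) * (1 + s ^ 2)⁻¹ =
      π / (1 + r) := by
    have hr2 : r ^ 2 - 1 ≠ 0 := by
      intro h
      have : (r - 1) * (r + 1) = 0 := by linarith
      rcases mul_eq_zero.1 this with h | h
      · exact hr1 (by linarith)
      · linarith
    have hd : ∀ s ∈ Ici (0 : ℝ), HasDerivAt
        (fun s => 2 / (r ^ 2 - 1) * (r * Real.arctan s - Real.arctan (r * s)))
        (2 * r * s ^ 2 / (1 + r ^ 2 * s ^ 2) * (1 + s ^ 2)⁻¹) s := by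
      intro s _
      have h1 : HasDerivAt (fun s => Real.arctan (r * s)) (1 / (1 + (r * s) ^ 2) * (r * 1)) s :=
        ((hasDerivAt_id s).const_mul r).arctan
      have h2 := (((Real.hasDerivAt_arctan s).const_mul r).sub h1).const_mul (2 / (r ^ 2 - 1))
      convert! h2 using 1
      have : 1 + r ^ 2 * s ^ 2 ≠ 0 := by positivity
      have : 1 + s ^ 2 ≠ 0 := by positivity
      field_simp
      ring
    have ht : Tendsto (fun s => 2 / (r ^ 2 - 1) * (r * Real.arctan s - Real.arctan (r * s)))
        atTop (𝓝 (2 / (r ^ 2 - 1) * (r * (π / 2) - π / 2))) := by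
      have h0 := tendsto_arctan_mul one_pos
      simp only [one_mul] at h0
      exact ((h0.const_mul r).sub (tendsto_arctan_mul hr)).const_mul _
    rw [integral_Ioi_of_hasDerivAt_of_nonneg' hd (fun s hs => by positivity) ht]
    simp
    have : 1 + r ≠ 0 := by positivity
    field_simp
    ring
  rw [← hval]
  refine (hasDerivAt_integral_of_dominated_loc_of_deriv_le (Ioi_mem_nhds (half_lt_self hr))
    (F' := fun r s => 2 * r * s ^ 2 / (1 + r ^ 2 * s ^ 2) * (1 + s ^ 2)⁻¹)
    (bound := fun s => 4 / r * (1 + s ^ 2)⁻¹)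
    (Eventually.of_forall fun r => (integrableOn_log_one_add_sq r).aestronglyMeasurable)
    (integrableOn_log_one_add_sq r) ?_ ?_ (integrableOn_inv_one_add_sq.const_mul _) ?_).2
  · have : Measurable fun s : ℝ => 2 * r * s ^ 2 / (1 + r ^ 2 * s ^ 2) * (1 + s ^ 2)⁻¹ := by
      fun_prop
    exact this.aestronglyMeasurable
  · refine Eventually.of_forall fun s q hq => ?_
    have hq : r / 2 < q := hq
    have hq0 : 0 < q := by linarith
    rw [Real.norm_of_nonneg (by positivity)]
    refine mul_le_mul_of_nonneg_right ?_ (by positivity)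
    rw [div_le_div_iff₀ (by positivity) hr]
    nlinarith [mul_le_mul_of_nonneg_right hq.le (by positivity : 0 ≤ q * s ^ 2)]
  · refine Eventually.of_forall fun s q hq => ?_
    refine HasDerivAt.mul_const ?_ _
    have h1 : HasDerivAt (fun q : ℝ => 1 + q ^ 2 * s ^ 2) (2 * q * s ^ 2) q := by
      simpa using (((hasDerivAt_id q).pow 2).mul_const (s ^ 2)).const_add 1
    exact h1.log (by positivity)

/-- A continuous function on `[0, ∞)` with zero derivative off `{0, 1}` is constant. -/
lemma eq_of_hasDerivAt_zero {f : ℝ → ℝ} (hc : ContinuousOn f (Ici 0))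
    (hd : ∀ x, 0 < x → x ≠ 1 → HasDerivAt f 0 x) {x : ℝ} (hx : 0 ≤ x) : f x = f 0 := by
  have h := integral_eq_of_hasDerivAt_off_countable_of_le f (fun _ => 0) hx
    (countable_singleton (1 : ℝ)) (hc.mono Icc_subset_Ici_self)
    (fun y hy => hd y hy.1.1 hy.2) (by simp)
  simp at h
  linarith

lemma etaC_zero : etaC 0 = 0 := by simp [etaC]

lemma continuousOn_etaC_I : ContinuousOn (fun r : ℝ => etaC (r * Complex.I)) (Ici 0) :=
  continuousOn_etaC.comp (by fun_prop) fun r _ => by simp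

lemma etaC_I_re_eq {r : ℝ} (hr : 0 ≤ r) : (etaC (r * Complex.I)).re = Real.log (1 + r) / 2 := by
  have h := eq_of_hasDerivAt_zero
    (f := fun r => (etaC (r * Complex.I)).re - Real.log (1 + r) / 2) ?_ ?_ hr
  · simp [etaC_zero] at h
    linarith
  · refine (Complex.continuous_re.comp_continuousOn continuousOn_etaC_I).sub ?_
    refine ContinuousOn.div_const (ContinuousOn.log (by fun_prop) fun x hx => ?_) _
    have : 0 ≤ x := hx
    positivity
  · intro x hx hx1
    have h1 := (hasDerivAt_integral_log_one_add_sq hx hx1).const_mul (1 / (2 * π))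
    simp_rw [etaC_I_re]
    have h2 : HasDerivAt (fun r : ℝ => Real.log (1 + r) / 2) (1 / (1 + x) / 2) x :=
      (((hasDerivAt_id x).const_add 1).log (by simp; positivity)).div_const 2
    convert! h1.sub h2 using 1
    field_simp
    ring

lemma integral_log_one_add_sq {r : ℝ} (hr : 0 ≤ r) :
    ∫ s in Ioi (0 : ℝ), Real.log (1 + r ^ 2 * s ^ 2) * (1 + s ^ 2)⁻¹ = π * Real.log (1 + r) := by
  have h := etaC_I_re_eq hr
  rw [etaC_I_re] at h
  have := Real.pi_pos
  rw [one_div, inv_mul_eq_iff_eq_mul₀ (by positivity)] at h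
  rw [h]
  ring

lemma etaC_re_lower {z : ℂ} (hz : 0 ≤ z.re) : Real.log (1 + ‖z‖) / 2 ≤ (etaC z).re := by
  rw [etaC_re z hz]
  have h : ∫ s in Ioi (0 : ℝ), 1 / 2 * (Real.log (1 + ‖z‖ ^ 2 * s ^ 2) * (1 + s ^ 2)⁻¹) ≤
      ∫ s in Ioi (0 : ℝ), Real.log ‖1 + z * s‖ * (1 + s ^ 2)⁻¹ := by
    refine setIntegral_mono_on ((integrableOn_log_one_add_sq _).const_mul _)
      (integrableOn_log_norm hz) measurableSet_Ioi fun s hs => ?_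
    have hs : 0 < s := hs
    rw [← mul_assoc]
    gcongr
    rw [one_div, ← div_eq_inv_mul, div_le_iff₀ two_pos,
      show Real.log ‖1 + z * s‖ * 2 = Real.log (‖1 + z * s‖ ^ 2) by simp [mul_comm]]
    refine Real.log_le_log (by positivity) ?_
    rw [← Complex.normSq_eq_norm_sq, ← Complex.normSq_eq_norm_sq, Complex.normSq_apply,
      Complex.normSq_apply]
    simp
    nlinarith [mul_nonneg hz hs.le]
  rw [integral_const_mul, integral_log_one_add_sq (norm_nonneg z)] at h
  calc Real.log (1 + ‖z‖) / 2 = 1 / π * (1 / 2 * (π * Real.log (1 + ‖z‖))) := by field_simp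
    _ ≤ _ := by gcongr

lemma etaC_re_upper {z : ℂ} (hz : 0 ≤ z.re) :
    (etaC z).re ≤ Real.log 2 / 4 + Real.log (1 + ‖z‖) / 2 := by
  rw [etaC_re z hz]
  have h : ∫ s in Ioi (0 : ℝ), Real.log ‖1 + z * s‖ * (1 + s ^ 2)⁻¹ ≤
      ∫ s in Ioi (0 : ℝ), (1 / 2 * Real.log 2 * (1 + s ^ 2)⁻¹ +
        1 / 2 * (Real.log (1 + ‖z‖ ^ 2 * s ^ 2) * (1 + s ^ 2)⁻¹)) := by
    refine setIntegral_mono_on (integrableOn_log_norm hz)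
      ((integrableOn_inv_one_add_sq.const_mul _).add
        ((integrableOn_log_one_add_sq _).const_mul _)) measurableSet_Ioi fun s hs => ?_
    have hs : 0 < s := hs
    have h1 : Real.log ‖1 + z * s‖ ≤
        1 / 2 * (Real.log 2 + Real.log (1 + ‖z‖ ^ 2 * s ^ 2)) := by
      rw [← Real.log_mul (by norm_num) (by positivity), one_div, ← div_eq_inv_mul,
        le_div_iff₀ two_pos,
        show Real.log ‖1 + z * s‖ * 2 = Real.log (‖1 + z * s‖ ^ 2) by simp [mul_comm]]
      have h2 := norm_one_add_mul_le z hs.le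
      have h3 := one_le_norm_one_add_mul hz hs.le
      refine Real.log_le_log (by positivity) ?_
      nlinarith [sq_nonneg (1 - ‖z‖ * s), mul_nonneg (norm_nonneg z) hs.le]
    calc _ ≤ 1 / 2 * (Real.log 2 + Real.log (1 + ‖z‖ ^ 2 * s ^ 2)) * (1 + s ^ 2)⁻¹ := by gcongr
      _ = _ := by ring
  rw [integral_add (integrableOn_inv_one_add_sq.const_mul _)
    ((integrableOn_log_one_add_sq _).const_mul _), integral_const_mul, integral_const_mul,
    integral_log_one_add_sq (norm_nonneg z), integral_Ioi_inv_one_add_sq] at h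
  calc _ ≤ 1 / π * (1 / 2 * Real.log 2 * (π / 2 - Real.arctan 0) +
        1 / 2 * (π * Real.log (1 + ‖z‖))) := by gcongr
    _ = _ := by
      simp
      field_simp
      ring

lemma norm_exp_neg_etaC_le {z : ℂ} (hz : 0 ≤ z.re) :
    ‖Complex.exp (-etaC z)‖ ≤ (1 + ‖z‖) ^ (-1 / 2 : ℝ) := by
  rw [Complex.norm_exp, Real.rpow_def_of_pos (by positivity), Complex.neg_re]
  gcongr
  linarith [etaC_re_lower hz]

lemma norm_exp_etaC_le {z : ℂ} (hz : 0 ≤ z.re) :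
    ‖Complex.exp (etaC z)‖ ≤ 2 * (1 + ‖z‖) ^ (1 / 2 : ℝ) := by
  rw [Complex.norm_exp, Real.rpow_def_of_pos (by positivity)]
  calc Real.exp (etaC z).re ≤ Real.exp (Real.log 2 + Real.log (1 + ‖z‖) * (1 / 2)) := by
        gcongr
        linarith [etaC_re_upper hz, Real.log_pos one_lt_two]
    _ = _ := by rw [Real.exp_add, Real.exp_log two_pos]

lemma etaC_I_im : (etaC Complex.I).im = π / 8 := by
  rw [etaC_im _ (by simp)]
  have hd : ∀ s ∈ Ici (0 : ℝ), HasDerivAt (fun s => Real.arctan s ^ 2 / 2)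
      (Complex.arg (1 + Complex.I * s) * (1 + s ^ 2)⁻¹) s := by
    intro s _
    have h1 : Complex.arg (1 + Complex.I * s) = Real.arctan s := by
      have := Complex.arg_of_re_nonneg (x := 1 + Complex.I * s) (by simp)
      rw [this, Real.arctan_eq_arcsin]
      congr 1
      have h2 := Complex.norm_add_mul_I 1 s
      rw [mul_comm Complex.I]
      push_cast at h2
      rw [h2]
      simp
    rw [h1]
    have h2 := ((Real.hasDerivAt_arctan s).pow 2).div_const 2
    convert! h2 using 1
    simp
    ring
  have ht : Tendsto (fun s => Real.arctan s ^ 2 / 2) atTop (𝓝 ((π / 2) ^ 2 / 2)) := by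
    have h0 := tendsto_arctan_mul one_pos
    simp only [one_mul] at h0
    exact (h0.pow 2).div_const 2
  rw [integral_Ioi_of_hasDerivAt_of_nonneg' hd (fun s hs => ?_) ht]
  · simp
    field_simp
    norm_num
  · have hs : 0 < s := hs
    have : 0 ≤ Complex.arg (1 + Complex.I * s) := by
      rw [Complex.arg_nonneg_iff]
      simp
      exact hs.le
    positivity

lemma etaC_I : etaC Complex.I = ((Real.log 2 / 2 : ℝ) : ℂ) + ((π / 8 : ℝ) : ℂ) * Complex.I := by
  have h1 := etaC_I_re_eq zero_le_one
  have h2 := etaC_I_im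
  norm_num at h1
  apply Complex.ext
  · simp [h1, -Complex.ofReal_div]
  · simp [h2, -Complex.ofReal_div]

lemma log_norm_one_add_ofReal_mul (t s : ℝ) :
    Real.log ‖1 + (t : ℂ) * (s : ℂ)‖ = Real.log (1 + t * s) := by
  rw [show 1 + (t : ℂ) * (s : ℂ) = ((1 + t * s : ℝ) : ℂ) by push_cast; ring, Complex.norm_real,
    Real.norm_eq_abs, Real.log_abs]

lemma integrableOn_log_one_add_mul {t : ℝ} (ht : 0 ≤ t) :
    IntegrableOn (fun s : ℝ => Real.log (1 + t * s) * (1 + s ^ 2)⁻¹) (Ioi 0) := by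
  simpa only [log_norm_one_add_ofReal_mul] using integrableOn_log_norm (z := t) (by simpa using ht)

lemma etaC_ofReal_re {t : ℝ} (ht : 0 ≤ t) : (etaC t).re =
    (1 / π) * ∫ s in Ioi (0 : ℝ), Real.log (1 + t * s) * (1 + s ^ 2)⁻¹ := by
  rw [etaC_re _ (by simpa using ht)]
  simp_rw [log_norm_one_add_ofReal_mul]

lemma hasDerivAt_integral_log_one_add_mul {t : ℝ} (ht : 0 < t) :
    HasDerivAt (fun t : ℝ => ∫ s in Ioi (0 : ℝ), Real.log (1 + t * s) * (1 + s ^ 2)⁻¹)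
      ((t * (π / 2) - Real.log t) / (1 + t ^ 2)) t := by
  have ht2 : 1 + t ^ 2 ≠ 0 := by positivity
  have hval : ∫ s in Ioi (0 : ℝ), s / (1 + t * s) * (1 + s ^ 2)⁻¹ =
      (t * (π / 2) - Real.log t) / (1 + t ^ 2) := by
    have hd : ∀ s ∈ Ici (0 : ℝ), HasDerivAt
        (fun s => (t * Real.arctan s + (Real.log (1 + s ^ 2) / 2 - Real.log (1 + t * s))) /
          (1 + t ^ 2))
        (s / (1 + t * s) * (1 + s ^ 2)⁻¹) s := by
      intro s hs
      have hs : 0 ≤ s := hs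
      have hp1 : 1 + s ^ 2 ≠ 0 := by positivity
      have hp2 : 1 + t * s ≠ 0 := by positivity
      have h1 : HasDerivAt (fun s => Real.log (1 + s ^ 2)) (2 * s / (1 + s ^ 2)) s := by
        refine HasDerivAt.log ?_ hp1
        simpa using ((hasDerivAt_id s).pow 2).const_add 1
      have h2 : HasDerivAt (fun s => Real.log (1 + t * s)) (t / (1 + t * s)) s := by
        refine HasDerivAt.log ?_ hp2
        simpa using ((hasDerivAt_id s).const_mul t).const_add 1
      have h3 := (((Real.hasDerivAt_arctan s).const_mul t).add ((h1.div_const 2).sub h2)).div_const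
        (1 + t ^ 2)
      convert! h3 using 1
      field_simp
      ring
    have hlog : Tendsto (fun s => Real.log (1 + s ^ 2) / 2 - Real.log (1 + t * s)) atTop
        (𝓝 (-Real.log t)) := by
      have hinv : Tendsto (fun s : ℝ => s⁻¹) atTop (𝓝 0) := tendsto_inv_atTop_zero
      have h1 : Tendsto (fun s : ℝ => Real.log ((s⁻¹) ^ 2 + 1) / 2 - Real.log (s⁻¹ + t)) atTop
          (𝓝 (Real.log (0 ^ 2 + 1) / 2 - Real.log (0 + t))) := by
        refine Tendsto.sub (Tendsto.div_const (Tendsto.log ((hinv.pow 2).add_const 1) ?_) 2)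
          (Tendsto.log (hinv.add_const t) ?_)
        · norm_num
        · linarith
      have h2 : Real.log (0 ^ 2 + 1) / 2 - Real.log (0 + t) = -Real.log t := by simp
      rw [h2] at h1
      refine h1.congr' ?_
      filter_upwards [eventually_gt_atTop 0] with s hs
      rw [show 1 + s ^ 2 = s ^ 2 * ((s⁻¹) ^ 2 + 1) by field_simp,
        show 1 + t * s = s * (s⁻¹ + t) by field_simp, Real.log_mul (by positivity) (by positivity),
        Real.log_mul (by positivity) (by positivity), Real.log_pow]
      push_cast
      ring
    have h0 := tendsto_arctan_mul one_pos
    simp only [one_mul] at h0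
    rw [integral_Ioi_of_hasDerivAt_of_nonneg' hd (fun s hs => ?_)
      (((h0.const_mul t).add hlog).div_const _)]
    · simp
      ring
    · have hs : 0 < s := hs
      positivity
  rw [← hval]
  refine (hasDerivAt_integral_of_dominated_loc_of_deriv_le (Ioi_mem_nhds (half_lt_self ht))
    (F := fun t s => Real.log (1 + t * s) * (1 + s ^ 2)⁻¹)
    (F' := fun t s => s / (1 + t * s) * (1 + s ^ 2)⁻¹)
    (bound := fun s => 2 / t * (1 + s ^ 2)⁻¹)
    (Eventually.of_forall fun t => ?_)
    (integrableOn_log_one_add_mul ht.le) ?_ ?_ (integrableOn_inv_one_add_sq.const_mul _) ?_).2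
  · have : Measurable fun s : ℝ => Real.log (1 + t * s) * (1 + s ^ 2)⁻¹ := by fun_prop
    exact this.aestronglyMeasurable
  · have : Measurable fun s : ℝ => s / (1 + t * s) * (1 + s ^ 2)⁻¹ := by fun_prop
    exact this.aestronglyMeasurable
  · filter_upwards [ae_restrict_mem measurableSet_Ioi] with s hs q hq
    have hs : 0 < s := hs
    have hq : t / 2 < q := hq
    have hq0 : 0 < q := by linarith
    rw [Real.norm_of_nonneg (by positivity)]
    refine mul_le_mul_of_nonneg_right ?_ (by positivity)
    rw [div_le_div_iff₀ (by positivity) ht]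
    nlinarith [mul_le_mul_of_nonneg_right hq.le hs.le]
  · filter_upwards [ae_restrict_mem measurableSet_Ioi] with s hs q hq
    have hs : 0 < s := hs
    have hq : t / 2 < q := hq
    have hq0 : 0 < q := by linarith
    refine HasDerivAt.mul_const ?_ _
    have h1 : HasDerivAt (fun q : ℝ => 1 + q * s) s q := by
      simpa using ((hasDerivAt_id q).mul_const s).const_add 1
    exact h1.log (by positivity)

lemma intervalIntegrable_log_div (a b : ℝ) :
    IntervalIntegrable (fun s : ℝ => Real.log |s| / (1 + s ^ 2)) volume a b := by
  simp_rw [Real.log_abs, div_eq_mul_inv]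
  refine intervalIntegral.intervalIntegrable_log'.mul_continuousOn ?_
  refine Continuous.continuousOn (Continuous.inv₀ (by fun_prop) fun x => ?_)
  positivity

lemma continuous_etaF : Continuous etaF := by
  refine Continuous.sub (Continuous.div_const (Continuous.log (by fun_prop) fun x => ?_) _)
    (Continuous.mul continuous_const
      (intervalIntegral.continuous_primitive intervalIntegrable_log_div 0))
  positivity

lemma hasDerivAt_etaF {t : ℝ} (ht : 0 < t) :
    HasDerivAt etaF (2 * t / (1 + t ^ 2) / 4 - 1 / π * (Real.log t / (1 + t ^ 2))) t := by
  have h1 : HasDerivAt (fun t : ℝ => Real.log (1 + t ^ 2)) (2 * t / (1 + t ^ 2)) t := by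
    refine HasDerivAt.log ?_ (by positivity)
    simpa using ((hasDerivAt_id t).pow 2).const_add 1
  refine (h1.div_const 4).sub (HasDerivAt.const_mul _ ?_)
  have hm : Measurable fun s : ℝ => Real.log |s| / (1 + s ^ 2) := by fun_prop
  rw [← Real.log_abs t]
  refine intervalIntegral.integral_hasDerivAt_right (intervalIntegrable_log_div 0 t)
    hm.stronglyMeasurable.stronglyMeasurableAtFilter ?_
  refine ContinuousAt.div (ContinuousAt.log (by fun_prop) (by positivity)) (by fun_prop)
    (by positivity)

lemma etaC_ofReal_re_eq {t : ℝ} (ht : 0 ≤ t) : (etaC t).re = etaF t := by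
  have hF0 : etaF 0 = 0 := by simp [etaF]
  have h := eq_of_hasDerivAt_zero (f := fun t : ℝ => (etaC t).re - etaF t) ?_ ?_ ht
  · simp [etaC_zero, hF0] at h
    linarith
  · refine ContinuousOn.sub (Complex.continuous_re.comp_continuousOn ?_)
      continuous_etaF.continuousOn
    exact continuousOn_etaC.comp (by fun_prop) fun r hr => by simpa using hr
  · intro x hx _
    have h1 : HasDerivAt (fun t : ℝ => (etaC t).re)
        (1 / π * ((x * (π / 2) - Real.log x) / (1 + x ^ 2))) x := by
      refine ((hasDerivAt_integral_log_one_add_mul hx).const_mul (1 / π)).congr_of_eventuallyEq ?_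
      filter_upwards [lt_mem_nhds hx] with t ht
      exact etaC_ofReal_re ht.le
    convert! h1.sub (hasDerivAt_etaF hx) using 1
    field_simp
    ring

lemma etaC_ofReal {t : ℝ} (ht : 0 ≤ t) : etaC t = (etaF t : ℂ) := by
  apply Complex.ext
  · simp [etaC_ofReal_re_eq ht]
  · rw [etaC_im _ (by simpa using ht), Complex.ofReal_im]
    refine mul_eq_zero_of_right _ (setIntegral_eq_zero_of_forall_eq_zero fun s hs => ?_)
    have hs : 0 < s := hs
    rw [show 1 + (t : ℂ) * (s : ℂ) = ((1 + t * s : ℝ) : ℂ) by push_cast; ring,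
      Complex.arg_ofReal_of_nonneg (by positivity), zero_mul]

/-- Rotation of the contour from the positive real axis to the positive imaginary axis. -/
lemma integral_Ioi_eq_I_mul_integral_Ioi {F : ℂ → ℂ} {C : ℝ} (hC : 0 ≤ C)
    (hc : ContinuousOn F {z | 0 ≤ z.re ∧ 0 ≤ z.im})
    (hd : ∀ z : ℂ, 0 < z.re → 0 < z.im → DifferentiableAt ℂ F z)
    (hb : ∀ z : ℂ, 0 ≤ z.re → 0 ≤ z.im → 2 ≤ ‖z‖ → ‖F z‖ ≤ C * ‖z‖ ^ (-3 / 2 : ℝ)) :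
    ∫ x in Ioi (0 : ℝ), F x = Complex.I * ∫ y in Ioi (0 : ℝ), F (y * Complex.I) := by
  have hi1 : IntegrableOn (fun x : ℝ => F x) (Ioi 0) := by
    refine integrableOn_Ioi_of_norm_le_rpow (C := C)
      (hc.comp (by fun_prop) fun x hx => by simpa using hx) fun x hx => ?_
    have hn : ‖(x : ℂ)‖ = x := by simp; linarith
    have h := hb x (by simp; linarith) (by simp) (by rw [hn]; exact hx)
    rwa [hn] at h
  have hi2 : IntegrableOn (fun y : ℝ => F (y * Complex.I)) (Ioi 0) := by
    refine integrableOn_Ioi_of_norm_le_rpow (C := C)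
      (hc.comp (by fun_prop) fun x hx => by simpa using hx) fun x hx => ?_
    have hn : ‖x * Complex.I‖ = x := by simp; linarith
    have h := hb (x * Complex.I) (by simp) (by simp; linarith) (by rw [hn]; exact hx)
    rwa [hn] at h
  have hsmall : ∀ R : ℝ, 2 ≤ R → ∀ z : ℂ, 0 ≤ z.re → 0 ≤ z.im → R ≤ ‖z‖ →
      ‖F z‖ ≤ C * R ^ (-3 / 2 : ℝ) := by
    intro R hR z h1 h2 h3
    refine (hb z h1 h2 (hR.trans h3)).trans (mul_le_mul_of_nonneg_left ?_ hC)
    exact Real.rpow_le_rpow_of_nonpos (by linarith) h3 (by norm_num)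
  have hdecay : Tendsto (fun R : ℝ => C * R ^ (-(1 / 2) : ℝ)) atTop (𝓝 0) := by
    simpa using (tendsto_rpow_neg_atTop (by norm_num : (0 : ℝ) < 1 / 2)).const_mul C
  have hpow : ∀ R : ℝ, 2 ≤ R → C * R ^ (-3 / 2 : ℝ) * |R - 0| = C * R ^ (-(1 / 2) : ℝ) := by
    intro R hR
    have hR0 : 0 < R := by linarith
    rw [sub_zero, abs_of_pos hR0, mul_assoc]
    nth_rw 2 [← Real.rpow_one R]
    rw [← Real.rpow_add hR0]
    norm_num
  have htop : Tendsto (fun R : ℝ => ∫ x in (0 : ℝ)..R, F (x + R * Complex.I)) atTop (𝓝 0) := by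
    refine squeeze_zero_norm' ?_ hdecay
    filter_upwards [eventually_ge_atTop 2] with R hR
    rw [← hpow R hR]
    refine intervalIntegral.norm_integral_le_of_norm_le_const fun x hx => ?_
    rw [uIoc_of_le (by linarith)] at hx
    refine hsmall R hR _ (by simpa using hx.1.le) (by simp; linarith) ?_
    refine le_trans ?_ ((le_abs_self _).trans (Complex.abs_im_le_norm _))
    simp
  have hright : Tendsto (fun R : ℝ => ∫ y in (0 : ℝ)..R, F (R + y * Complex.I)) atTop (𝓝 0) := by
    refine squeeze_zero_norm' ?_ hdecay
    filter_upwards [eventually_ge_atTop 2] with R hR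
    rw [← hpow R hR]
    refine intervalIntegral.norm_integral_le_of_norm_le_const fun x hx => ?_
    rw [uIoc_of_le (by linarith)] at hx
    refine hsmall R hR _ (by simp; linarith) (by simpa using hx.1.le) ?_
    refine le_trans ?_ ((le_abs_self _).trans (Complex.abs_re_le_norm _))
    simp
  have h1 := intervalIntegral_tendsto_integral_Ioi 0 hi1 tendsto_id
  have h2 := intervalIntegral_tendsto_integral_Ioi 0 hi2 tendsto_id
  have hlim := ((h1.sub htop).add (hright.const_mul Complex.I)).sub (h2.const_mul Complex.I)
  have hzero : ∀ᶠ R : ℝ in atTop, (∫ x in (0 : ℝ)..id R, F x) -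
      (∫ x in (0 : ℝ)..R, F (x + R * Complex.I)) +
      Complex.I * (∫ y in (0 : ℝ)..R, F (R + y * Complex.I)) -
      Complex.I * (∫ y in (0 : ℝ)..id R, F (y * Complex.I)) = 0 := by
    filter_upwards [eventually_ge_atTop 0] with R hR
    have h := Complex.integral_boundary_rect_eq_zero_of_continuousOn_of_differentiableOn F 0
      (R + R * Complex.I) (hc.mono ?_) ?_
    · simpa using h
    · intro z hz
      simp [Complex.mem_reProdIm, uIcc_of_le hR] at hz
      exact ⟨hz.1.1, hz.2.1⟩
    · intro z hz
      simp [Complex.mem_reProdIm, hR] at hz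
      exact (hd z hz.1.1 hz.2.1).differentiableWithinAt
  have := tendsto_nhds_unique (hlim.congr' hzero) tendsto_const_nhds
  linear_combination this

lemma one_add_sq_ne_zero {z : ℂ} (h1 : z ≠ Complex.I) (h2 : 0 ≤ z.im) : 1 + z ^ 2 ≠ 0 := by
  intro h
  have h3 : (z - Complex.I) * (z + Complex.I) = 0 := by
    linear_combination h - Complex.I_sq
  rcases mul_eq_zero.1 h3 with h | h
  · exact h1 (sub_eq_zero.1 h)
  · have := congrArg Complex.im h
    simp at this
    linarith

lemma dslope_div_add_I {N : ℂ → ℂ} {z : ℂ} (h : z ≠ Complex.I) :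
    dslope N Complex.I z / (z + Complex.I) = (N z - N Complex.I) / (1 + z ^ 2) := by
  rw [dslope_of_ne _ h, slope_def_field, div_div]
  congr 1
  linear_combination -Complex.I_sq

/-- Contour rotation for `N(t)/(1+t²)`, with the pole at `I` subtracted. -/
lemma integral_div_one_add_sq_sub {N : ℂ → ℂ} {D : ℝ} (hD : 0 ≤ D)
    (hc : ContinuousOn N {z | 0 ≤ z.re ∧ 0 ≤ z.im})
    (hd : ∀ z : ℂ, 0 ≤ z.re → 0 < z.im → DifferentiableAt ℂ N z)
    (hb : ∀ z : ℂ, 0 ≤ z.re → 0 ≤ z.im → ‖N z‖ ≤ D * (1 + ‖z‖) ^ (1 / 2 : ℝ)) :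
    IntegrableOn (fun t : ℝ => N t / (1 + (t : ℂ) ^ 2)) (Ioi 0) ∧
    (∫ t in Ioi (0 : ℝ), N t / (1 + (t : ℂ) ^ 2)) - N Complex.I * (π / 2) =
      Complex.I * ∫ s in Ioi (0 : ℝ), (N (s * Complex.I) - N Complex.I) / (1 - (s : ℂ) ^ 2) := by
  have hreal : ∀ t : ℝ, (t : ℂ) ≠ Complex.I := fun t h => by
    simpa using congrArg Complex.im h
  have hfrac : ∀ w z : ℂ, 2 ≤ ‖z‖ → ‖w‖ ≤ 3 * D * ‖z‖ ^ (1 / 2 : ℝ) →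
      ‖w / (1 + z ^ 2)‖ ≤ 6 * D * ‖z‖ ^ (-3 / 2 : ℝ) := by
    intro w z hz hw
    have hz0 : 0 < ‖z‖ := by linarith
    have h1 : ‖z‖ ^ 2 / 2 ≤ ‖1 + z ^ 2‖ := by
      have := norm_sub_norm_le (z ^ 2) (-1)
      rw [sub_neg_eq_add, norm_neg, norm_one, norm_pow, add_comm] at this
      nlinarith
    rw [norm_div, rpow_neg_three_halves hz0]
    calc ‖w‖ / ‖1 + z ^ 2‖ ≤ (3 * D * ‖z‖ ^ (1 / 2 : ℝ)) / (‖z‖ ^ 2 / 2) := by gcongr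
      _ = _ := by ring
  have hNint : IntegrableOn (fun t : ℝ => N t / (1 + (t : ℂ) ^ 2)) (Ioi 0) := by
    refine integrableOn_Ioi_of_norm_le_rpow (C := 6 * D) ?_ fun x hx => ?_
    · refine ContinuousOn.div (hc.comp (by fun_prop) fun x hx => by simpa using hx)
        (by fun_prop) fun x _ => one_add_sq_ne_zero (hreal x) (by simp)
    · have hn : ‖(x : ℂ)‖ = x := by simp; linarith
      have := hfrac (N x) x (by rw [hn]; exact hx) ?_
      · rwa [hn] at this
      · refine (hb x (by simp; linarith) (by simp)).trans ?_
        rw [hn]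
        have h1 := one_add_rpow_half_le hx
        have h2 : 0 ≤ x ^ (1 / 2 : ℝ) := by positivity
        nlinarith
  refine ⟨hNint, ?_⟩
  have hadd : ∀ z : ℂ, 0 ≤ z.im → z + Complex.I ≠ 0 := by
    intro z hz h
    have := congrArg Complex.im h
    simp at this
    linarith
  have hrot := integral_Ioi_eq_I_mul_integral_Ioi
    (F := fun z => dslope N Complex.I z / (z + Complex.I)) (C := 6 * D) (by positivity) ?_ ?_ ?_
  · have hl : ∫ x in Ioi (0 : ℝ), dslope N Complex.I x / (x + Complex.I) =
        (∫ t in Ioi (0 : ℝ), N t / (1 + (t : ℂ) ^ 2)) - N Complex.I * (π / 2) := by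
      have hval : ∫ t in Ioi (0 : ℝ), N Complex.I / (1 + (t : ℂ) ^ 2) =
          N Complex.I * (π / 2) := by
        simp_rw [div_eq_mul_inv]
        rw [integral_const_mul]
        congr 1
        have := integral_ofReal (𝕜 := ℂ) (μ := volume.restrict (Ioi 0))
          (f := fun s : ℝ => (1 + s ^ 2)⁻¹)
        rw [integral_Ioi_inv_one_add_sq] at this
        simpa [div_eq_mul_inv] using this
      have hNint2 : IntegrableOn (fun t : ℝ => N Complex.I / (1 + (t : ℂ) ^ 2)) (Ioi 0) := by
        have h : Integrable _ _ := (integrableOn_inv_one_add_sq.ofReal (𝕜 := ℂ)).const_mul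
          (N Complex.I)
        refine h.congr (Eventually.of_forall fun s => ?_)
        simp [div_eq_mul_inv]
      rw [← hval, ← integral_sub hNint hNint2]
      refine integral_congr_ae (Eventually.of_forall fun t => ?_)
      simp only [dslope_div_add_I (hreal t), sub_div]
    rw [← hl, hrot]
    congr 1
    refine integral_congr_ae ?_
    have hne : ∀ᵐ s : ℝ ∂(volume.restrict (Ioi 0)), s ≠ 1 :=
      ae_restrict_of_ae (Measure.ae_ne volume 1)
    filter_upwards [hne] with s hs
    rw [dslope_div_add_I]
    · congr 1
      rw [mul_pow, Complex.I_sq]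
      ring
    · intro h
      have := congrArg Complex.im h
      simp at this
      exact hs this
  · intro z hz
    refine ContinuousWithinAt.div ?_ (by fun_prop) (hadd z hz.2)
    rcases eq_or_ne z Complex.I with rfl | h
    · exact (continuousAt_dslope_same.2 (hd _ (by simp) (by simp))).continuousWithinAt
    · exact (continuousWithinAt_dslope_of_ne h).2 (hc z hz)
  · intro z h1 h2
    have h : z ≠ Complex.I := by
      rintro rfl
      simp at h1
    exact ((differentiableAt_dslope_of_ne h).2 (hd z h1.le h2)).div (by fun_prop) (hadd z h2.le)
  · intro z h1 h2 h3
    have h : z ≠ Complex.I := by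
      rintro rfl
      norm_num at h3
    simp only [dslope_div_add_I h]
    refine hfrac _ z h3 ((norm_sub_le _ _).trans ?_)
    have h4 := hb z h1 h2
    have h5 := hb Complex.I (by simp) (by simp)
    have h6 := one_add_rpow_half_le h3
    have h7 : (1 + ‖Complex.I‖) ^ (1 / 2 : ℝ) ≤ ‖z‖ ^ (1 / 2 : ℝ) := by
      refine Real.rpow_le_rpow (by positivity) ?_ (by norm_num)
      rw [Complex.norm_I]
      linarith
    nlinarith

/-- The density of the Laplace transform appearing in `uPlus`. -/
noncomputable def kernelPlus (t : ℝ) : ℂ := Complex.exp (-(etaF t : ℂ)) / (t + Complex.I)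

/-- The density of the Laplace transform appearing in `uMinus`. -/
noncomputable def kernelMinus (t : ℝ) : ℂ := Complex.exp (etaF t : ℂ) / (1 + (t : ℂ) ^ 2)

lemma ofReal_add_I_ne_zero (t : ℝ) : (t : ℂ) + Complex.I ≠ 0 := by
  intro h
  have := congrArg Complex.im h
  simp at this

lemma ofReal_sub_I_ne_zero (t : ℝ) : (t : ℂ) - Complex.I ≠ 0 := by
  intro h
  have := congrArg Complex.im h
  simp at this

lemma exp_etaC_mul_I {s : ℝ} (hs : 0 ≤ s) :
    Complex.exp (etaC (s * Complex.I)) =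
      (1 + s) * (starRingEnd ℂ) (Complex.exp (-etaC (s * Complex.I))) := by
  rw [← Complex.exp_conj, map_neg]
  have h : ((1 : ℂ) + s) = Complex.exp (etaC (s * Complex.I) +
      (starRingEnd ℂ) (etaC (s * Complex.I))) := by
    rw [Complex.add_conj, etaC_I_re_eq hs, mul_div_cancel₀ _ two_ne_zero,
      ← Complex.ofReal_exp, Real.exp_log (by linarith)]
    push_cast
    rfl
  rw [h, ← Complex.exp_add]
  congr 1
  ring

lemma norm_exp_I_mul_mul_le {z : ℂ} (hz : 0 ≤ z.im) {Y : ℝ} (hY : 0 ≤ Y) :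
    ‖Complex.exp (Complex.I * z * Y)‖ ≤ 1 := by
  rw [Complex.norm_exp, Real.exp_le_one_iff]
  simp
  positivity

lemma integral_transforms {Y : ℝ} (hY : 0 ≤ Y) :
    IntegrableOn (fun t : ℝ => Complex.exp (-(Complex.I * t * Y)) * kernelPlus t) (Ioi 0) ∧
    IntegrableOn (fun t : ℝ => Complex.exp (Complex.I * t * Y) * kernelMinus t) (Ioi 0) ∧
    ∫ t in Ioi (0 : ℝ), Complex.exp (Complex.I * t * Y) * kernelMinus t =
      -Complex.I * (∫ t in Ioi (0 : ℝ), Complex.exp (-(Complex.I * t * Y)) * kernelPlus t)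
        + √2 * π * Complex.exp (-Y) * Complex.exp (Complex.I * (π / 8)) := by
  set N₁ : ℂ → ℂ := fun z => Complex.exp (Complex.I * z * Y) * Complex.exp (-etaC z) *
    (z + Complex.I) with hN₁
  set N₂ : ℂ → ℂ := fun z => Complex.exp (Complex.I * z * Y) * Complex.exp (etaC z) with hN₂
  have hsub : {z : ℂ | 0 ≤ z.re ∧ 0 ≤ z.im} ⊆ {z | 0 ≤ z.re} := fun z hz => hz.1
  have hec : ContinuousOn etaC {z : ℂ | 0 ≤ z.re ∧ 0 ≤ z.im} := continuousOn_etaC.mono hsub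
  obtain ⟨hi₁, he₁⟩ := integral_div_one_add_sq_sub (N := N₁) (D := 1) zero_le_one (by fun_prop)
    (fun z h1 h2 => by
      have := differentiableAt_etaC h1 h2
      fun_prop)
    (fun z h1 h2 => by
      have h3 := norm_exp_I_mul_mul_le h2 hY
      have h4 := norm_exp_neg_etaC_le h1
      have h5 : ‖z + Complex.I‖ ≤ 1 + ‖z‖ := (norm_add_le _ _).trans (by simp [add_comm])
      have h6 : (1 + ‖z‖) ^ (1 / 2 : ℝ) = (1 + ‖z‖) ^ (-1 / 2 : ℝ) * (1 + ‖z‖) := by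
        rw [← Real.rpow_add_one (by positivity)]
        norm_num
      simp only [hN₁, norm_mul]
      rw [one_mul, h6]
      refine mul_le_mul ?_ h5 (norm_nonneg _) (by positivity)
      calc _ ≤ 1 * (1 + ‖z‖) ^ (-1 / 2 : ℝ) :=
            mul_le_mul h3 h4 (norm_nonneg _) zero_le_one
        _ = _ := one_mul _)
  obtain ⟨hi₂, he₂⟩ := integral_div_one_add_sq_sub (N := N₂) (D := 2) zero_le_two (by fun_prop)
    (fun z h1 h2 => by
      have := differentiableAt_etaC h1 h2
      fun_prop)
    (fun z h1 h2 => by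
      have h3 := norm_exp_I_mul_mul_le h2 hY
      have h4 := norm_exp_etaC_le h1
      simp only [hN₂, norm_mul]
      calc _ ≤ 1 * (2 * (1 + ‖z‖) ^ (1 / 2 : ℝ)) :=
            mul_le_mul h3 h4 (norm_nonneg _) zero_le_one
        _ = _ := one_mul _)
  have hN : ∀ s : ℝ, 0 ≤ s →
      N₂ (s * Complex.I) = Complex.I * (starRingEnd ℂ) (N₁ (s * Complex.I)) := by
    intro s hs
    have h1 : Complex.I * (s * Complex.I) * Y = ((-(s * Y) : ℝ) : ℂ) := by
      push_cast
      linear_combination (s : ℂ) * Y * Complex.I_sq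
    simp only [hN₁, hN₂]
    rw [exp_etaC_mul_I hs, h1, ← Complex.ofReal_exp]
    simp only [map_mul, map_add, Complex.conj_ofReal, Complex.conj_I]
    linear_combination ((Real.exp (-(s * Y)) : ℂ) *
      (starRingEnd ℂ) (Complex.exp (-etaC (s * Complex.I))) * (1 + s)) * Complex.I_sq
  have hNI : N₂ Complex.I = Complex.I * (starRingEnd ℂ) (N₁ Complex.I) := by
    simpa using hN 1 zero_le_one
  have hB : ∫ s in Ioi (0 : ℝ), (N₂ (s * Complex.I) - N₂ Complex.I) / (1 - (s : ℂ) ^ 2) =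
      Complex.I * (starRingEnd ℂ)
        (∫ s in Ioi (0 : ℝ), (N₁ (s * Complex.I) - N₁ Complex.I) / (1 - (s : ℂ) ^ 2)) := by
    rw [← integral_conj, ← integral_const_mul]
    refine setIntegral_congr_fun measurableSet_Ioi fun s hs => ?_
    simp only [hN s (le_of_lt hs), hNI, map_div₀, map_sub, map_one, map_pow, Complex.conj_ofReal]
    ring
  have hp : ∀ t : ℝ, 0 < t → (starRingEnd ℂ) (N₁ t / (1 + (t : ℂ) ^ 2)) =
      Complex.exp (-(Complex.I * t * Y)) * kernelPlus t := by
    intro t ht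
    have h2 : (1 : ℂ) + t ^ 2 = (t - Complex.I) * (t + Complex.I) := by
      linear_combination Complex.I_sq
    simp only [hN₁, kernelPlus]
    rw [etaC_ofReal ht.le]
    simp only [map_div₀, map_mul, map_add, ← Complex.exp_conj, map_neg, map_pow, map_one,
      Complex.conj_ofReal, Complex.conj_I]
    rw [h2]
    have h3 := ofReal_add_I_ne_zero t
    have h4 := ofReal_sub_I_ne_zero t
    have h5 : -Complex.I * (t : ℂ) * Y = -(Complex.I * t * Y) := by ring
    rw [h5]
    field_simp
    ring
  have hm : ∀ t : ℝ, 0 < t → N₂ t / (1 + (t : ℂ) ^ 2) =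
      Complex.exp (Complex.I * t * Y) * kernelMinus t := by
    intro t ht
    simp only [hN₂, kernelMinus]
    rw [etaC_ofReal ht.le]
    ring
  have hJ₁ : (starRingEnd ℂ) (∫ t in Ioi (0 : ℝ), N₁ t / (1 + (t : ℂ) ^ 2)) =
      ∫ t in Ioi (0 : ℝ), Complex.exp (-(Complex.I * t * Y)) * kernelPlus t := by
    rw [← integral_conj]
    exact setIntegral_congr_fun measurableSet_Ioi fun t ht => hp t ht
  have hJ₂ : ∫ t in Ioi (0 : ℝ), N₂ t / (1 + (t : ℂ) ^ 2) =
      ∫ t in Ioi (0 : ℝ), Complex.exp (Complex.I * t * Y) * kernelMinus t :=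
    setIntegral_congr_fun measurableSet_Ioi fun t ht => hm t ht
  have hval : N₂ Complex.I = √2 * Complex.exp (-Y) * Complex.exp (Complex.I * (π / 8)) := by
    have h1 : Complex.exp ((Real.log 2 / 2 : ℝ) : ℂ) = (√2 : ℝ) := by
      rw [← Complex.ofReal_exp, Real.sqrt_eq_rpow, Real.rpow_def_of_pos two_pos]
      congr 2
      ring
    simp only [hN₂]
    rw [etaC_I, Complex.exp_add, h1, Complex.I_mul_I]
    push_cast
    rw [mul_comm (π / 8 : ℂ), neg_one_mul]
    ring
  refine ⟨?_, ?_, ?_⟩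
  · refine IntegrableOn.congr_fun (f := fun t : ℝ => (starRingEnd ℂ) (N₁ t / (1 + (t : ℂ) ^ 2)))
      ?_ (fun t ht => hp t ht) measurableSet_Ioi
    exact (Complex.conjCLE.toContinuousLinearMap).integrable_comp hi₁
  · exact hi₂.congr_fun (fun t ht => hm t ht) measurableSet_Ioi
  · rw [← hJ₁, ← hJ₂]
    have he₁' := congrArg (starRingEnd ℂ) he₁
    simp only [map_sub, map_mul, map_div₀, Complex.conj_I, Complex.conj_ofReal,
      map_ofNat] at he₁'
    rw [hB] at he₂
    have hc : (starRingEnd ℂ) (N₁ Complex.I) = -Complex.I * N₂ Complex.I := by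
      rw [hNI]
      linear_combination ((starRingEnd ℂ) (N₁ Complex.I)) * Complex.I_sq
    rw [hc] at he₁'
    have hI := Complex.I_sq
    have hfin : √2 * π * Complex.exp (-Y) * Complex.exp (Complex.I * (π / 8)) =
      (π : ℂ) * N₂ Complex.I := by rw [hval]; ring
    rw [hfin]
    linear_combination he₂ + Complex.I * he₁' + (-N₂ Complex.I * (π / 2)) * hI

/-- The Laplace transform of `g`. -/
noncomputable def laplaceT (g : ℝ → ℂ) (z : ℂ) : ℂ :=
  ∫ t in Ioi (0 : ℝ), Complex.exp (-(t * z)) * g t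

lemma norm_exp_neg_mul_le_one {t : ℝ} (ht : 0 ≤ t) {z : ℂ} (hz : 0 ≤ z.re) :
    ‖Complex.exp (-(t * z))‖ ≤ 1 := by
  rw [Complex.norm_exp, Real.exp_le_one_iff]
  simp
  positivity

lemma aestronglyMeasurable_laplace {g : ℝ → ℂ} (hg : IntegrableOn g (Ioi 0)) (z : ℂ) :
    AEStronglyMeasurable (fun t : ℝ => Complex.exp (-(t * z)) * g t)
      (volume.restrict (Ioi 0)) :=
  (by fun_prop : Continuous fun t : ℝ => Complex.exp (-(t * z))).aestronglyMeasurable.mul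
    hg.aestronglyMeasurable

lemma integrableOn_laplace {g : ℝ → ℂ} (hg : IntegrableOn g (Ioi 0)) {z : ℂ} (hz : 0 ≤ z.re) :
    IntegrableOn (fun t : ℝ => Complex.exp (-(t * z)) * g t) (Ioi 0) := by
  refine Integrable.mono' (Integrable.norm hg) (aestronglyMeasurable_laplace hg z) ?_
  filter_upwards [ae_restrict_mem measurableSet_Ioi] with t ht
  rw [norm_mul]
  exact mul_le_of_le_one_left (norm_nonneg _) (norm_exp_neg_mul_le_one (le_of_lt ht) hz)

lemma norm_laplaceT_le {g : ℝ → ℂ} (hg : IntegrableOn g (Ioi 0)) {z : ℂ} (hz : 0 ≤ z.re) :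
    ‖laplaceT g z‖ ≤ ∫ t in Ioi (0 : ℝ), ‖g t‖ := by
  refine norm_integral_le_of_norm_le (Integrable.norm hg) ?_
  filter_upwards [ae_restrict_mem measurableSet_Ioi] with t ht
  rw [norm_mul]
  exact mul_le_of_le_one_left (norm_nonneg _) (norm_exp_neg_mul_le_one (le_of_lt ht) hz)

lemma continuousOn_laplaceT {g : ℝ → ℂ} (hg : IntegrableOn g (Ioi 0)) :
    ContinuousOn (laplaceT g) {z | 0 ≤ z.re} := by
  refine continuousOn_of_dominated (bound := fun t => ‖g t‖)
    (fun z _ => aestronglyMeasurable_laplace hg z) (fun z hz => ?_) (Integrable.norm hg) ?_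
  · filter_upwards [ae_restrict_mem measurableSet_Ioi] with t ht
    rw [norm_mul]
    exact mul_le_of_le_one_left (norm_nonneg _) (norm_exp_neg_mul_le_one (le_of_lt ht) hz)
  · exact Eventually.of_forall fun t => by fun_prop

lemma hasDerivAt_laplaceT {g : ℝ → ℂ} (hg : IntegrableOn g (Ioi 0)) {z : ℂ} (hz : 0 < z.re) :
    IntegrableOn (fun t : ℝ => -(t : ℂ) * Complex.exp (-(t * z)) * g t) (Ioi 0) ∧
    HasDerivAt (laplaceT g)
      (∫ t in Ioi (0 : ℝ), -(t : ℂ) * Complex.exp (-(t * z)) * g t) z := by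
  refine hasDerivAt_integral_of_dominated_loc_of_deriv_le
    (F := fun w t => Complex.exp (-(t * w)) * g t)
    (F' := fun w t => -(t : ℂ) * Complex.exp (-(t * w)) * g t)
    (s := {w | z.re / 2 < w.re}) (bound := fun t => (z.re / 2)⁻¹ * ‖g t‖)
    ((isOpen_lt continuous_const Complex.continuous_re).mem_nhds (by simp; linarith))
    (Eventually.of_forall fun w => aestronglyMeasurable_laplace hg w)
    (integrableOn_laplace hg hz.le) ?_ ?_ ((Integrable.norm hg).const_mul _) ?_
  · exact (by fun_prop : Continuous fun t : ℝ =>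
      -(t : ℂ) * Complex.exp (-(t * z))).aestronglyMeasurable.mul hg.aestronglyMeasurable
  · filter_upwards [ae_restrict_mem measurableSet_Ioi] with t ht w hw
    have ht : 0 < t := ht
    have hw : z.re / 2 < w.re := hw
    rw [norm_mul]
    refine mul_le_mul_of_nonneg_right ?_ (norm_nonneg _)
    rw [norm_mul, norm_neg, Complex.norm_real, Real.norm_of_nonneg ht.le, Complex.norm_exp]
    have h1 : t * (z.re / 2) ≤ Real.exp (t * (z.re / 2)) := by
      linarith [Real.add_one_le_exp (t * (z.re / 2))]
    have h2 : Real.exp (-(t * w)).re ≤ (Real.exp (t * (z.re / 2)))⁻¹ := by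
      rw [← Real.exp_neg]
      simp
      nlinarith
    calc _ ≤ t * (Real.exp (t * (z.re / 2)))⁻¹ := by gcongr
      _ ≤ _ := by
        rw [← div_eq_mul_inv, div_le_iff₀ (Real.exp_pos _), ← div_eq_inv_mul,
          le_div_iff₀ (by linarith)]
        exact h1
  · refine Eventually.of_forall fun t w _ => HasDerivAt.mul_const ?_ (g t)
    have h : HasDerivAt (fun w : ℂ => -(t * w)) (-(t : ℂ)) w := by
      simpa using (hasDerivAt_id w).const_mul (t : ℂ) |>.fun_neg
    simpa [mul_comm] using h.cexp

lemma rectangle_integral_eq_zero_of_re_sign {f : ℂ → ℂ} {z w : ℂ}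
    (hc : ContinuousOn f (Complex.Rectangle z w))
    (hd : ∀ v, 0 < v.im → v.re ≠ 0 → DifferentiableAt ℂ f v)
    (him : ∀ v ∈ Complex.Rectangle z w, 0 < v.im)
    (hre : 0 ≤ min z.re w.re ∨ max z.re w.re ≤ 0) :
    (∫ x : ℝ in z.re..w.re, f (x + z.im * Complex.I)) -
      (∫ x : ℝ in z.re..w.re, f (x + w.im * Complex.I)) +
      Complex.I • (∫ y : ℝ in z.im..w.im, f (w.re + y * Complex.I)) -
      Complex.I • (∫ y : ℝ in z.im..w.im, f (z.re + y * Complex.I)) = 0 := by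
  refine Complex.integral_boundary_rect_eq_zero_of_continuousOn_of_differentiableOn f z w hc ?_
  intro v hv
  refine (hd v (him v ?_) ?_).differentiableWithinAt
  · exact ⟨Ioo_subset_Icc_self hv.1, Ioo_subset_Icc_self hv.2⟩
  · have h : v.re ∈ Ioo _ _ := hv.1
    rcases hre with h' | h'
    · exact (h'.trans_lt h.1).ne'
    · exact (h.2.trans_le h').ne

/-- A function continuous on the upper half-plane and holomorphic off the imaginary axis is
holomorphic. -/
lemma differentiableAt_of_continuousOn_of_re_ne_zero {f : ℂ → ℂ}
    (hc : ContinuousOn f {z | 0 < z.im})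
    (hd : ∀ z, 0 < z.im → z.re ≠ 0 → DifferentiableAt ℂ f z) {z₀ : ℂ} (hz₀ : 0 < z₀.im) :
    DifferentiableAt ℂ f z₀ := by
  have hopen : IsOpen {z : ℂ | 0 < z.im} := isOpen_lt continuous_const Complex.continuous_im
  obtain ⟨r, hr, hball⟩ := Metric.isOpen_iff.1 hopen z₀ hz₀
  have hcons : Complex.IsConservativeOn f (Metric.ball z₀ r) := by
    intro z w hzw
    rw [← add_eq_zero_iff_eq_neg, Complex.wedgeIntegral_add_wedgeIntegral_eq]
    have hsub : Complex.Rectangle z w ⊆ {z | 0 < z.im} := hzw.trans hball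
    have hcR := hc.mono hsub
    by_cases h1 : 0 ≤ min z.re w.re ∨ max z.re w.re ≤ 0
    · exact rectangle_integral_eq_zero_of_re_sign hcR hd hsub h1
    push Not at h1
    have h0 : (0 : ℝ) ∈ uIcc z.re w.re := ⟨h1.1.le, h1.2.le⟩
    have hz : z.re ∈ uIcc z.re w.re := left_mem_uIcc
    have hw : w.re ∈ uIcc z.re w.re := right_mem_uIcc
    have hs₁ : Complex.Rectangle z (0 + w.im * Complex.I) ⊆ Complex.Rectangle z w := by
      intro v hv
      have h2 : v.re ∈ uIcc z.re 0 := by simpa using hv.1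
      have h3 : v.im ∈ uIcc z.im w.im := by simpa using hv.2
      exact ⟨uIcc_subset_uIcc hz h0 h2, h3⟩
    have hs₂ : Complex.Rectangle (0 + z.im * Complex.I) w ⊆ Complex.Rectangle z w := by
      intro v hv
      have h2 : v.re ∈ uIcc 0 w.re := by simpa using hv.1
      have h3 : v.im ∈ uIcc z.im w.im := by simpa using hv.2
      exact ⟨uIcc_subset_uIcc h0 hw h2, h3⟩
    have hsign : (z.re ≤ 0 ∧ 0 ≤ w.re) ∨ (w.re ≤ 0 ∧ 0 ≤ z.re) := by
      rcases le_total z.re w.re with h | h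
      · left; simpa [h] using And.intro h1.1.le h1.2.le
      · right; simpa [h] using And.intro h1.1.le h1.2.le
    have e₁ := rectangle_integral_eq_zero_of_re_sign (hcR.mono hs₁) hd (hs₁.trans hsub)
      (by simp; tauto)
    have e₂ := rectangle_integral_eq_zero_of_re_sign (hcR.mono hs₂) hd (hs₂.trans hsub)
      (by simp; tauto)
    simp at e₁ e₂
    have hNint : ∀ b ∈ uIcc z.im w.im, ∀ x₁ ∈ uIcc z.re w.re, ∀ x₂ ∈ uIcc z.re w.re,
        IntervalIntegrable (fun x : ℝ => f (x + b * Complex.I)) volume x₁ x₂ := by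
      intro b hb x₁ hx₁ x₂ hx₂
      refine ContinuousOn.intervalIntegrable (hcR.comp (by fun_prop) fun x hx => ?_)
      have : x ∈ uIcc z.re w.re := uIcc_subset_uIcc hx₁ hx₂ hx
      exact ⟨by simpa using this, by simpa using hb⟩
    rw [← intervalIntegral.integral_add_adjacent_intervals
        (hNint _ left_mem_uIcc _ hz _ h0) (hNint _ left_mem_uIcc _ h0 _ hw),
      ← intervalIntegral.integral_add_adjacent_intervals
        (hNint _ right_mem_uIcc _ hz _ h0) (hNint _ right_mem_uIcc _ h0 _ hw)]
    simp only [smul_eq_mul]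
    linear_combination e₁ + e₂
  have hex := hcons.isExactOn_ball (hc.mono hball)
  exact (hex.differentiableOn Metric.isOpen_ball).differentiableAt (Metric.ball_mem_nhds z₀ hr)

lemma integrableOn_kernelPlus : IntegrableOn kernelPlus (Ioi 0) := by
  simpa using (integral_transforms le_rfl).1

lemma integrableOn_kernelMinus : IntegrableOn kernelMinus (Ioi 0) := by
  simpa using (integral_transforms le_rfl).2.1

/-- The holomorphic function whose real part is `uPlus`. -/
noncomputable def holPlus (z : ℂ) : ℂ :=
  -Complex.I * Complex.exp (Complex.I * z + Complex.I * (π / 8)) -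
    ((√2 / (2 * π) : ℝ) : ℂ) * laplaceT kernelPlus z

/-- The holomorphic function whose real part is `uMinus`. -/
noncomputable def holMinus (z : ℂ) : ℂ :=
  -Complex.I * ((√2 / (2 * π) : ℝ) : ℂ) * laplaceT kernelMinus (-z)

/-- The holomorphic function on the upper half-plane whose real part is `uSol`. -/
noncomputable def holSol (z : ℂ) : ℂ := if 0 ≤ z.re then holPlus z else holMinus z

lemma holPlus_eq_holMinus {z : ℂ} (hre : z.re = 0) (him : 0 ≤ z.im) :
    holPlus z = holMinus z := by
  obtain ⟨Y, rfl⟩ : ∃ Y : ℝ, z = Y * Complex.I := ⟨z.im, by apply Complex.ext <;> simp [hre]⟩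
  have hY : 0 ≤ Y := by simpa using him
  have h := (integral_transforms hY).2.2
  have h1 : laplaceT kernelMinus (-(Y * Complex.I)) =
      ∫ t in Ioi (0 : ℝ), Complex.exp (Complex.I * t * Y) * kernelMinus t := by
    rw [laplaceT]
    congr 1 with t
    congr 2
    ring
  have h2 : laplaceT kernelPlus (Y * Complex.I) =
      ∫ t in Ioi (0 : ℝ), Complex.exp (-(Complex.I * t * Y)) * kernelPlus t := by
    rw [laplaceT]
    congr 1 with t
    congr 2
    ring
  have h3 : ((√2 / (2 * π) : ℝ) : ℂ) * (√2 * π) = 1 := by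
    have : √2 / (2 * π) * (√2 * π) = 1 := by
      have h4 := Real.mul_self_sqrt (zero_le_two (α := ℝ))
      have h5 := Real.pi_pos
      field_simp
      linarith
    exact_mod_cast this
  have h4 : Complex.exp (Complex.I * (Y * Complex.I) + Complex.I * (π / 8)) =
      Complex.exp (-Y) * Complex.exp (Complex.I * (π / 8)) := by
    rw [← Complex.exp_add]
    congr 1
    linear_combination (Y : ℂ) * Complex.I_sq
  rw [holPlus, holMinus, h1, h, h2, h4]
  set J := ∫ t in Ioi (0 : ℝ), Complex.exp (-(Complex.I * t * Y)) * kernelPlus t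
  set c := ((√2 / (2 * π) : ℝ) : ℂ)
  linear_combination (-c * J) * Complex.I_sq +
    (Complex.I * Complex.exp (-Y) * Complex.exp (Complex.I * (π / 8))) * h3

lemma exp_neg_mul_ofReal (t lam x y : ℝ) : Complex.exp (-(t * (lam * (x + y * Complex.I)))) =
    (Real.exp (-t * lam * x) : ℂ) *
      ((Real.cos (t * lam * y) : ℂ) - (Real.sin (t * lam * y) : ℂ) * Complex.I) := by
  have h : -((t : ℂ) * (lam * (x + y * Complex.I))) =
      ((-t * lam * x : ℝ) : ℂ) + ((-(t * lam * y) : ℝ) : ℂ) * Complex.I := by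
    push_cast
    ring
  rw [h, Complex.exp_add, Complex.exp_mul_I, ← Complex.ofReal_exp, ← Complex.ofReal_cos,
    ← Complex.ofReal_sin, Real.cos_neg, Real.sin_neg]
  push_cast
  ring

lemma kernelPlus_eq (t : ℝ) : kernelPlus t =
    ((Real.exp (-etaF t) / (1 + t ^ 2) : ℝ) : ℂ) * (t - Complex.I) := by
  have h1 := ofReal_add_I_ne_zero t
  have h2 := ofReal_sub_I_ne_zero t
  have h3 : (1 : ℂ) + t ^ 2 = (t - Complex.I) * (t + Complex.I) := by
    linear_combination Complex.I_sq
  rw [kernelPlus]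
  push_cast
  rw [h3]
  field_simp

lemma kernelMinus_eq (t : ℝ) : kernelMinus t =
    ((Real.exp (etaF t) / (1 + t ^ 2) : ℝ) : ℂ) := by
  rw [kernelMinus]
  push_cast
  rfl

lemma uPlus_eq_re {lam x y : ℝ} (hx : 0 ≤ lam * x) :
    uPlus lam x y = (holPlus (lam * (x + y * Complex.I))).re := by
  have h1 : (-Complex.I * Complex.exp (Complex.I * (lam * (x + y * Complex.I)) +
      Complex.I * (π / 8))).re = Real.exp (-lam * y) * Real.sin (lam * x + π / 8) := by
    have h : Complex.I * (lam * (x + y * Complex.I)) + Complex.I * (π / 8) =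
        ((-lam * y : ℝ) : ℂ) + ((lam * x + π / 8 : ℝ) : ℂ) * Complex.I := by
      push_cast
      linear_combination (lam * y : ℂ) * Complex.I_sq
    rw [h, Complex.exp_add, Complex.exp_mul_I, ← Complex.ofReal_exp, ← Complex.ofReal_cos,
      ← Complex.ofReal_sin]
    simp [-Complex.ofReal_exp, -Complex.ofReal_cos, -Complex.ofReal_sin]
  have hz : 0 ≤ ((lam : ℂ) * (x + y * Complex.I)).re := by simpa using hx
  have h2 := integral_re (𝕜 := ℂ) (integrableOn_laplace integrableOn_kernelPlus hz)
  rw [holPlus, Complex.sub_re, h1, Complex.re_ofReal_mul, uPlus]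
  congr 2
  rw [laplaceT]
  refine Eq.trans ?_ h2
  congr 1 with t
  rw [exp_neg_mul_ofReal, kernelPlus_eq]
  simp [-Complex.ofReal_exp, -Complex.ofReal_cos, -Complex.ofReal_sin, -Complex.ofReal_div]
  ring

lemma uMinus_eq_re {lam x y : ℝ} (hx : lam * x ≤ 0) :
    uMinus lam x y = (holMinus (lam * (x + y * Complex.I))).re := by
  have hz : 0 ≤ (-((lam : ℂ) * (x + y * Complex.I))).re := by simpa using hx
  have h2 := integral_im (𝕜 := ℂ) (integrableOn_laplace integrableOn_kernelMinus hz)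
  have h3 : holMinus (lam * (x + y * Complex.I)) = ((√2 / (2 * π) : ℝ) : ℂ) *
      (-Complex.I * laplaceT kernelMinus (-(lam * (x + y * Complex.I)))) := by
    rw [holMinus]
    ring
  rw [h3, Complex.re_ofReal_mul, uMinus]
  congr 1
  have h4 : ∀ w : ℂ, (-Complex.I * w).re = w.im := fun w => by simp
  rw [laplaceT, h4]
  refine Eq.trans ?_ h2
  congr 1 with t
  have h5 : -((lam : ℂ) * (x + y * Complex.I)) =
      lam * ((-x : ℝ) + (-y : ℝ) * Complex.I) := by
    push_cast
    ring
  rw [h5, exp_neg_mul_ofReal, kernelMinus_eq]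
  simp [-Complex.ofReal_exp, -Complex.ofReal_cos, -Complex.ofReal_sin, -Complex.ofReal_div]
  ring

lemma uSol_eq_re {lam : ℝ} (hlam : 0 < lam) (x y : ℝ) :
    uSol lam x y = (holSol (lam * (x + y * Complex.I))).re := by
  have h : ((lam : ℂ) * (x + y * Complex.I)).re = lam * x := by simp
  rw [uSol, holSol, h]
  by_cases hx : 0 ≤ x
  · rw [if_pos hx, if_pos (by positivity), uPlus_eq_re (by positivity)]
  · push Not at hx
    have h1 : lam * x < 0 := mul_neg_of_pos_of_neg hlam hx
    rw [if_neg hx.not_ge, if_neg h1.not_ge, uMinus_eq_re h1.le]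

lemma holPlus_bound {z : ℂ} (hre : 0 ≤ z.re) (him : 0 ≤ z.im) :
    ‖holPlus z‖ ≤ 1 + √2 / (2 * π) * ∫ t in Ioi (0 : ℝ), ‖kernelPlus t‖ := by
  refine (norm_sub_le _ _).trans (add_le_add ?_ ?_)
  · rw [norm_mul, norm_neg, Complex.norm_I, one_mul, Complex.norm_exp, Real.exp_le_one_iff]
    simpa using him
  · rw [norm_mul, Complex.norm_real, Real.norm_of_nonneg (by positivity)]
    exact mul_le_mul_of_nonneg_left (norm_laplaceT_le integrableOn_kernelPlus hre) (by positivity)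

lemma holMinus_bound {z : ℂ} (hre : z.re ≤ 0) :
    ‖holMinus z‖ ≤ √2 / (2 * π) * ∫ t in Ioi (0 : ℝ), ‖kernelMinus t‖ := by
  rw [holMinus, norm_mul, norm_mul, norm_neg, Complex.norm_I, one_mul, Complex.norm_real,
    Real.norm_of_nonneg (by positivity)]
  exact mul_le_mul_of_nonneg_left
    (norm_laplaceT_le integrableOn_kernelMinus (by simpa using hre)) (by positivity)

lemma exists_holSol_bound : ∃ M : ℝ, ∀ z : ℂ, 0 ≤ z.im → ‖holSol z‖ ≤ M := by
  refine ⟨max (1 + √2 / (2 * π) * ∫ t in Ioi (0 : ℝ), ‖kernelPlus t‖)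
    (√2 / (2 * π) * ∫ t in Ioi (0 : ℝ), ‖kernelMinus t‖), fun z hz => ?_⟩
  rw [holSol]
  split_ifs with h
  · exact (holPlus_bound h hz).trans (le_max_left _ _)
  · exact (holMinus_bound (not_le.1 h).le).trans (le_max_right _ _)

lemma continuousOn_holPlus : ContinuousOn holPlus {z | 0 ≤ z.re} := by
  have h := continuousOn_laplaceT integrableOn_kernelPlus
  unfold holPlus
  fun_prop

lemma continuousOn_holMinus : ContinuousOn holMinus {z | z.re ≤ 0} := by
  have h : ContinuousOn (fun z => laplaceT kernelMinus (-z)) {z | z.re ≤ 0} :=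
    (continuousOn_laplaceT integrableOn_kernelMinus).comp (by fun_prop)
      fun z hz => by simpa using hz
  unfold holMinus
  fun_prop

lemma continuousOn_holSol : ContinuousOn holSol {z | 0 ≤ z.im} := by
  have hU : {z : ℂ | 0 ≤ z.im} =
      ({z : ℂ | 0 ≤ z.im} ∩ {z | 0 ≤ z.re}) ∪ ({z : ℂ | 0 ≤ z.im} ∩ {z | z.re ≤ 0}) := by
    rw [← inter_union_distrib_left]
    ext z
    simp [le_total]
  have him : IsClosed {z : ℂ | 0 ≤ z.im} := isClosed_le continuous_const Complex.continuous_im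
  rw [hU]
  refine ContinuousOn.union_of_isClosed ?_ ?_
    (him.inter (isClosed_le continuous_const Complex.continuous_re))
    (him.inter (isClosed_le Complex.continuous_re continuous_const))
  · refine (continuousOn_holPlus.mono inter_subset_right).congr fun z hz => ?_
    exact if_pos hz.2
  · refine (continuousOn_holMinus.mono inter_subset_right).congr fun z hz => ?_
    rw [holSol]
    split_ifs with h
    · exact holPlus_eq_holMinus (le_antisymm hz.2 h) hz.1
    · rfl

lemma hasDerivAt_holPlus {z : ℂ} (hz : 0 < z.re) :
    HasDerivAt holPlus (Complex.exp (Complex.I * z + Complex.I * (π / 8)) +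
      ((√2 / (2 * π) : ℝ) : ℂ) *
        ∫ t in Ioi (0 : ℝ), (t : ℂ) * Complex.exp (-(t * z)) * kernelPlus t) z := by
  have h1 := (hasDerivAt_laplaceT integrableOn_kernelPlus hz).2
  have h2 : HasDerivAt (fun z => Complex.I * z + Complex.I * (π / 8)) Complex.I z := by
    simpa using ((hasDerivAt_id z).const_mul Complex.I).add_const (Complex.I * (π / 8) : ℂ)
  have h3 := (h2.cexp.const_mul (-Complex.I)).sub
    (h1.const_mul ((√2 / (2 * π) : ℝ) : ℂ))
  refine h3.congr_deriv ?_
  simp only [neg_mul, integral_neg]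
  linear_combination (-Complex.exp (Complex.I * z + Complex.I * (π / 8))) * Complex.I_sq

lemma differentiableAt_holMinus {z : ℂ} (hz : z.re < 0) : DifferentiableAt ℂ holMinus z := by
  have h1 := (hasDerivAt_laplaceT integrableOn_kernelMinus
    (z := -z) (by simpa using hz)).2.differentiableAt
  have h2 : DifferentiableAt ℂ (fun z => laplaceT kernelMinus (-z)) z :=
    DifferentiableAt.comp (g := laplaceT kernelMinus) z h1 differentiableAt_id.neg
  unfold holMinus
  fun_prop

lemma differentiableAt_holSol {z : ℂ} (hz : 0 < z.im) : DifferentiableAt ℂ holSol z := by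
  refine differentiableAt_of_continuousOn_of_re_ne_zero
    (continuousOn_holSol.mono fun z (hz : 0 < z.im) => hz.le) (fun w _ hw => ?_) hz
  rcases hw.lt_or_gt with h | h
  · refine (differentiableAt_holMinus h).congr_of_eventuallyEq ?_
    filter_upwards [(isOpen_lt Complex.continuous_re continuous_const).mem_nhds h] with v hv
    exact if_neg (not_le.2 hv)
  · refine (hasDerivAt_holPlus h).differentiableAt.congr_of_eventuallyEq ?_
    filter_upwards [(isOpen_lt continuous_const Complex.continuous_re).mem_nhds h] with v hv
    exact if_pos (le_of_lt hv)

lemma hasDerivAt_re_comp_horizontal {f : ℂ → ℂ} {f' : ℂ} {x y : ℝ}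
    (h : HasDerivAt f f' (x + y * Complex.I)) :
    HasDerivAt (fun s : ℝ => (f (s + y * Complex.I)).re) f'.re x := by
  have h1 : HasDerivAt (fun s : ℂ => s + y * Complex.I) 1 (x : ℂ) :=
    (hasDerivAt_id _).add_const _
  have h2 : HasDerivAt (fun s : ℂ => f (s + y * Complex.I)) (f' * 1) (x : ℂ) :=
    HasDerivAt.comp (x : ℂ) h h1
  simpa using h2.real_of_complex

lemma hasDerivAt_re_comp_vertical {f : ℂ → ℂ} {f' : ℂ} {x y : ℝ}
    (h : HasDerivAt f f' (x + y * Complex.I)) :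
    HasDerivAt (fun s : ℝ => (f (x + s * Complex.I)).re) (Complex.I * f').re y := by
  have h1 : HasDerivAt (fun s : ℂ => x + s * Complex.I) Complex.I (y : ℂ) := by
    simpa using ((hasDerivAt_id (y : ℂ)).mul_const Complex.I).const_add (x : ℂ)
  have h2 : HasDerivAt (fun s : ℂ => f (x + s * Complex.I)) (f' * Complex.I) (y : ℂ) :=
    HasDerivAt.comp (y : ℂ) h h1
  rw [mul_comm]
  exact h2.real_of_complex

/-- The real part of a holomorphic function on the upper half-plane is harmonic. -/
lemma deriv_deriv_re_add_deriv_deriv_re {f : ℂ → ℂ}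
    (hf : ∀ z : ℂ, 0 < z.im → DifferentiableAt ℂ f z)
    {x y : ℝ} (hy : 0 < y) :
    deriv (fun x' : ℝ => deriv (fun x'' : ℝ => (f (x'' + y * Complex.I)).re) x') x +
      deriv (fun y' : ℝ => deriv (fun y'' : ℝ => (f (x + y'' * Complex.I)).re) y') y = 0 := by
  have him : ∀ a b : ℝ, 0 < b → 0 < ((a : ℂ) + b * Complex.I).im := fun a b hb => by simpa
  have hd : ∀ a b : ℝ, 0 < b →
      HasDerivAt f (deriv f (a + b * Complex.I)) (a + b * Complex.I) :=
    fun a b hb => (hf _ (him a b hb)).hasDerivAt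
  have hopen : IsOpen {z : ℂ | 0 < z.im} := isOpen_lt continuous_const Complex.continuous_im
  have hf' : DifferentiableOn ℂ f {z : ℂ | 0 < z.im} :=
    fun z hz => (hf z hz).differentiableWithinAt
  have hdd : HasDerivAt (deriv f) (deriv (deriv f) (x + y * Complex.I)) (x + y * Complex.I) :=
    ((hf'.deriv hopen).differentiableAt (hopen.mem_nhds (him x y hy))).hasDerivAt
  have h1 : (fun x' : ℝ => deriv (fun x'' : ℝ => (f (x'' + y * Complex.I)).re) x') =
      fun x' : ℝ => (deriv f (x' + y * Complex.I)).re :=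
    funext fun x' => (hasDerivAt_re_comp_horizontal (hd x' y hy)).deriv
  have h2 : (fun y' : ℝ => deriv (fun y'' : ℝ => (f (x + y'' * Complex.I)).re) y') =ᶠ[𝓝 y]
      fun y' : ℝ => (Complex.I * deriv f (x + y' * Complex.I)).re := by
    filter_upwards [lt_mem_nhds hy] with y' hy'
    exact (hasDerivAt_re_comp_vertical (hd x y' hy')).deriv
  rw [h1, h2.deriv_eq, (hasDerivAt_re_comp_horizontal hdd).deriv,
    (hasDerivAt_re_comp_vertical (f := fun z => Complex.I * deriv f z)
      (hdd.const_mul Complex.I)).deriv, ← mul_assoc, Complex.I_mul_I]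
  simp

lemma re_I_mul_deriv_holPlus {r : ℝ} (hr : 0 < r) :
    (Complex.I * deriv holPlus r).re = -(holPlus r).re := by
  have hz : 0 < (r : ℂ).re := by simpa
  have h1 := (hasDerivAt_laplaceT integrableOn_kernelPlus hz).1
  have h2 := integrableOn_laplace integrableOn_kernelPlus hz.le
  have h1' : IntegrableOn (fun t : ℝ => (t : ℂ) * Complex.exp (-(t * r)) * kernelPlus t)
      (Ioi 0) := by
    simpa using h1.neg
  have h3 : (Complex.I * ∫ t in Ioi (0 : ℝ), (t : ℂ) * Complex.exp (-(t * r)) * kernelPlus t).re =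
      (laplaceT kernelPlus r).re := by
    have e1 := integral_im (𝕜 := ℂ) h1'
    have e2 := integral_re (𝕜 := ℂ) h2
    have e3 : ∀ w : ℂ, (Complex.I * w).re = -w.im := fun w => by simp
    rw [e3, laplaceT]
    refine (congrArg Neg.neg e1.symm).trans (Eq.trans ?_ e2)
    rw [← integral_neg]
    congr 1 with t
    rw [kernelPlus_eq, ← Complex.ofReal_mul, ← Complex.ofReal_neg, ← Complex.ofReal_exp]
    simp [-Complex.ofReal_exp, -Complex.ofReal_div, -Complex.ofReal_mul, -Complex.ofReal_neg]
    ring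
  rw [(hasDerivAt_holPlus hz).deriv, holPlus, mul_add, mul_left_comm, Complex.add_re,
    Complex.sub_re, Complex.re_ofReal_mul, Complex.re_ofReal_mul, h3]
  simp only [neg_mul, Complex.neg_re]
  ring

lemma uSol_eq_zero {lam x : ℝ} (hx : x ≤ 0) : uSol lam x 0 = 0 := by
  have h : uSol lam x 0 = uMinus lam x 0 := by
    rw [uSol]
    split_ifs with h0
    · obtain rfl : x = 0 := le_antisymm hx h0
      rw [uPlus_eq_re (by simp), uMinus_eq_re (by simp),
        holPlus_eq_holMinus (by simp) (by simp)]
    · rfl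
  rw [h, uMinus]
  simp

theorem mixed_steklov_half_plane (lam : ℝ) (hlam : 0 < lam) :
    -- (i) the two formulas agree when x = 0
    (∀ y : ℝ, 0 ≤ y → uPlus lam 0 y = uMinus lam 0 y) ∧
    -- (ii) u is bounded and continuous on the closed upper half-plane
    (∃ M : ℝ, ∀ x y : ℝ, 0 ≤ y → |uSol lam x y| ≤ M) ∧
    ContinuousOn (fun p : ℝ × ℝ => uSol lam p.1 p.2) {p : ℝ × ℝ | 0 ≤ p.2} ∧
    -- (iii) u is harmonic in the open upper half-plane
    (∀ x y : ℝ, 0 < y →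
      deriv (fun x' => deriv (fun x'' => uSol lam x'' y) x') x
        + deriv (fun y' => deriv (fun y'' => uSol lam x y'') y') y = 0) ∧
    -- (iv) the Dirichlet condition on (−∞,0]
    (∀ x : ℝ, x ≤ 0 → uSol lam x 0 = 0) ∧
    -- (v) the Steklov condition on (0,∞)
    (∀ x : ℝ, 0 < x →
      Tendsto (fun y : ℝ => (uSol lam x y - uSol lam x 0) / y) (𝓝[>] 0)
        (𝓝 (-lam * uSol lam x 0))) := by
  refine ⟨fun y hy => ?_, ?_, ?_, fun x y hy => ?_, fun x hx => uSol_eq_zero hx,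
    fun x hx => ?_⟩
  · rw [uPlus_eq_re (by simp), uMinus_eq_re (by simp), holPlus_eq_holMinus]
    · simp
    · simpa using by positivity
  · obtain ⟨M, hM⟩ := exists_holSol_bound
    refine ⟨M, fun x y hy => ?_⟩
    rw [uSol_eq_re hlam]
    exact (Complex.abs_re_le_norm _).trans (hM _ (by simpa using by positivity))
  · simp_rw [uSol_eq_re hlam]
    refine Complex.continuous_re.comp_continuousOn
      (continuousOn_holSol.comp (by fun_prop) fun p (hp : 0 ≤ p.2) => ?_)
    simpa using by positivity
  · simp_rw [uSol_eq_re hlam]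
    refine deriv_deriv_re_add_deriv_deriv_re (f := fun z => holSol (lam * z)) (fun z hz => ?_) hy
    have h : 0 < ((lam : ℂ) * z).im := by simpa using mul_pos hlam hz
    exact (differentiableAt_holSol h).comp z (by fun_prop)
  · have hu : ∀ y, uSol lam x y = (holPlus (lam * (x + y * Complex.I))).re := fun y => by
      rw [uSol, if_pos hx.le, uPlus_eq_re (by positivity)]
    have hr : 0 < lam * x := mul_pos hlam hx
    have h0 : HasDerivAt holPlus (deriv holPlus ((lam * x : ℝ) : ℂ))
        (lam * (x + (0 : ℝ) * Complex.I)) := by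
      have h : (lam : ℂ) * (x + (0 : ℝ) * Complex.I) = ((lam * x : ℝ) : ℂ) := by
        push_cast
        ring
      rw [h]
      exact (hasDerivAt_holPlus (by simpa)).differentiableAt.hasDerivAt
    have h1 : HasDerivAt (fun z : ℂ => (lam : ℂ) * z) lam (x + (0 : ℝ) * Complex.I) := by
      simpa using (hasDerivAt_id ((x : ℂ) + (0 : ℝ) * Complex.I)).const_mul (lam : ℂ)
    have h2 := hasDerivAt_re_comp_vertical (f := fun z => holPlus (lam * z))
      (HasDerivAt.comp ((x : ℂ) + (0 : ℝ) * Complex.I) h0 h1)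
    have h3 : HasDerivAt (uSol lam x) (-lam * uSol lam x 0) 0 := by
      refine (h2.congr_of_eventuallyEq (Eventually.of_forall hu)).congr_deriv ?_
      rw [← mul_assoc, mul_comm, Complex.re_ofReal_mul, re_I_mul_deriv_holPlus hr, hu]
      simp
    refine (h3.tendsto_slope_zero_right).congr fun y => ?_
    rw [zero_add, smul_eq_mul, div_eq_inv_mul]
end

section
/- For every t ∈ ℝ one has (1/4)·log(1+t²) − (1/π)·∫₀^t log|s|/(1+s²) ds = (1/π)·∫_{−∞}^0 log|t−s|/(1+s²) ds; in particular the integral on the right-hand side converges for every real t. -/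
open Real MeasureTheory Set

theorem Real.image_arctan_Iio_zero : arctan '' Iio 0 = Ioo (-(π / 2)) 0 := by
  ext y
  constructor
  · rintro ⟨x, hx, rfl⟩
    exact ⟨neg_pi_div_two_lt_arctan x, arctan_lt_zero.2 hx⟩
  · rintro ⟨h₁, h₂⟩
    have h : arctan (tan y) = y := arctan_tan h₁ (h₂.trans (by positivity))
    exact ⟨tan y, arctan_lt_zero.1 (h.symm ▸ h₂), h⟩

theorem log_sub_eq_log_sin_arctan_sub {s t : ℝ} (h : s ≠ t) :
    log (t - s) =
      log (sin (arctan t - arctan s)) - log (cos (arctan t)) - log (cos (arctan s)) := by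
  have ht := (cos_arctan_pos t).ne'
  have hs := (cos_arctan_pos s).ne'
  have key : sin (arctan t - arctan s) = (t - s) * cos (arctan t) * cos (arctan s) := by
    have h₁ := tan_mul_cos ht
    have h₂ := tan_mul_cos hs
    rw [tan_arctan] at h₁ h₂
    rw [sin_sub, ← h₁, ← h₂]
    ring
  have hts : t - s ≠ 0 := sub_ne_zero.2 h.symm
  rw [key, log_mul (mul_ne_zero hts ht) hs, log_mul hts ht]
  ring

theorem integral_log_div_one_add_sq (t : ℝ) :
    ∫ s in (0 : ℝ)..t, log s / (1 + s ^ 2) =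
      (∫ x in (0 : ℝ)..arctan t, log (sin x)) - ∫ x in (0 : ℝ)..arctan t, log (cos x) := by
  have h := intervalIntegral.integral_deriv_smul_comp_of_deriv_nonneg (a := 0) (b := t)
    (f := arctan) (f' := fun s => 1 / (1 + s ^ 2)) (g := fun x => log (tan x))
    continuous_arctan.continuousOn (fun s _ => hasDerivAt_arctan s)
    (fun s _ => by positivity)
  have hl : ∫ s in (0 : ℝ)..t, log s / (1 + s ^ 2) =
      ∫ s in (0 : ℝ)..t, (1 / (1 + s ^ 2)) • ((fun x => log (tan x)) ∘ arctan) s := by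
    congr 1 with s
    simp only [Function.comp_apply, tan_arctan, smul_eq_mul]
    ring
  rw [hl, h, arctan_zero]
  have hs : IntervalIntegrable (fun x => log (sin x)) volume 0 (arctan t) :=
    intervalIntegrable_log_sin
  have hc : IntervalIntegrable (fun x => log (cos x)) volume 0 (arctan t) :=
    intervalIntegrable_log_cos
  rw [← intervalIntegral.integral_sub hs hc]
  refine intervalIntegral.integral_congr fun x hx => ?_
  have hmem : x ∈ Ioo (-(π / 2)) (π / 2) :=
    ordConnected_Ioo.uIcc_subset ⟨by linarith [pi_pos], by positivity⟩ (arctan_mem_Ioo t) hx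
  have hcos : cos x ≠ 0 := (cos_pos_of_mem_Ioo hmem).ne'
  simp only [tan_eq_sin_div_cos]
  by_cases hsin : sin x = 0
  · have : cos x = 1 ∨ cos x = -1 := sin_eq_zero_iff_cos_eq.1 hsin
    rcases this with h | h <;> simp [hsin, h]
  · exact log_div hsin hcos

theorem integral_log_cos_eq_integral_log_sin (a b : ℝ) :
    ∫ x in a..b, log (cos x) = ∫ x in (a + π / 2)..(b + π / 2), log (sin x) := by
  rw [← intervalIntegral.integral_comp_add_right (fun x => log (sin x))]
  simp only [sin_add_pi_div_two]

theorem intervalIntegrable_log_sin_sub_sub (a c b d : ℝ) :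
    IntervalIntegrable (fun x => log (sin (a - x)) - c - log (cos x)) volume b d := by
  have h : IntervalIntegrable (fun x => log (sin (a - x))) volume b d := by
    simpa using (intervalIntegrable_log_sin (a := a - b) (b := a - d)).comp_sub_left a
  exact (h.sub intervalIntegrable_const).sub intervalIntegrable_log_cos

theorem integral_log_sin_sub_sub (a c : ℝ) :
    ∫ x in (-(π / 2))..0, (log (sin (a - x)) - c - log (cos x)) =
      (∫ x in (0 : ℝ)..a, log (cos x)) - (∫ x in (0 : ℝ)..a, log (sin x)) - π / 2 * c := by
  have h : IntervalIntegrable (fun x => log (sin (a - x))) volume (-(π / 2)) 0 := by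
    simpa using (intervalIntegrable_log_sin (a := a + π / 2) (b := a)).comp_sub_left a
  have hc : IntervalIntegrable (fun x => log (cos x)) volume (-(π / 2)) 0 :=
    intervalIntegrable_log_cos
  rw [intervalIntegral.integral_sub (h.sub intervalIntegrable_const) hc,
    intervalIntegral.integral_sub h intervalIntegrable_const,
    intervalIntegral.integral_comp_sub_left (fun x => log (sin x)),
    integral_log_cos_eq_integral_log_sin, integral_log_cos_eq_integral_log_sin,
    intervalIntegral.integral_const, smul_eq_mul]
  have hi (x y : ℝ) : IntervalIntegrable (fun x => log (sin x)) volume x y :=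
    intervalIntegrable_log_sin
  have h₁ := intervalIntegral.integral_add_adjacent_intervals (hi 0 a) (hi a (a + π / 2))
  have h₂ := intervalIntegral.integral_add_adjacent_intervals (hi 0 (π / 2))
    (hi (π / 2) (a + π / 2))
  simp only [sub_zero, sub_neg_eq_add, neg_add_cancel, zero_add] at *
  linarith

theorem log_cos_arctan (t : ℝ) : log (cos (arctan t)) = -(log (1 + t ^ 2) / 2) := by
  rw [cos_arctan, one_div, log_inv, log_sqrt (by positivity)]

theorem etaF_eq_integral_Iio (t : ℝ) :
    IntegrableOn (fun s : ℝ => Real.log |t - s| / (1 + s ^ 2)) (Iio 0) ∧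
    etaF t = (1 / Real.pi) * ∫ s in Iio (0 : ℝ), Real.log |t - s| / (1 + s ^ 2) := by
  set K : ℝ → ℝ := fun x => log (sin (arctan t - x)) - log (cos (arctan t)) - log (cos x) with hK
  have hae : (fun s : ℝ => |1 / (1 + s ^ 2)| • K (arctan s)) =ᵐ[volume.restrict (Iio 0)]
      fun s => log |t - s| / (1 + s ^ 2) := by
    filter_upwards [Measure.ae_ne (volume.restrict (Iio 0)) t] with s hs
    rw [log_abs, log_sub_eq_log_sin_arctan_sub hs, abs_of_nonneg (by positivity), smul_eq_mul]
    ring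
  have hderiv : ∀ s ∈ Iio (0 : ℝ), HasDerivWithinAt arctan (1 / (1 + s ^ 2)) (Iio 0) s :=
    fun s _ => (hasDerivAt_arctan s).hasDerivWithinAt
  have hπ : -(π / 2) ≤ 0 := by linarith [pi_pos]
  constructor
  · have h := (intervalIntegrable_iff_integrableOn_Ioo_of_le hπ).1
      (intervalIntegrable_log_sin_sub_sub (arctan t) (log (cos (arctan t))) (-(π / 2)) 0)
    rw [← image_arctan_Iio_zero, integrableOn_image_iff_integrableOn_abs_deriv_smul
      measurableSet_Iio hderiv arctan_injective.injOn] at h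
    exact h.congr hae
  · rw [← integral_congr_ae hae, ← integral_image_eq_integral_abs_deriv_smul measurableSet_Iio
      hderiv arctan_injective.injOn K, image_arctan_Iio_zero, ← integral_Ioc_eq_integral_Ioo,
      ← intervalIntegral.integral_of_le hπ, hK, integral_log_sin_sub_sub, log_cos_arctan, etaF]
    simp only [log_abs]
    rw [integral_log_div_one_add_sq]
    field_simp
    ring
end

section
/- For every z ∈ ℂ with Im z > 0 one has B(z) + B(−z) = log(1 − i·z), where log is the principal branch of the complex logarithm; that is, (1/π)·∫_{−∞}^0 (log(z−s) + log(−z−s))/(1+s²) ds = log(1 − i·z). -/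
open Real MeasureTheory Set Complex

/-- `B z = (1/π)·∫_{−∞}^0 log(z−s)/(1+s²) ds`, principal branch of `log`. -/
noncomputable def Bfun (z : ℂ) : ℂ :=
  (1 / (Real.pi : ℂ)) * ∫ s in Iio (0 : ℝ), Complex.log (z - (s : ℂ)) / (1 + (s : ℂ) ^ 2)

open Filter Topology

lemma norm_log_le_of_sq_le {u : ℂ} {a C s : ℝ} (ha : 0 < a) (hau : a ≤ ‖u‖) (hC : 1 ≤ C)
    (hu : ‖u‖ ^ 2 ≤ C * (1 + s ^ 2)) :
    ‖Complex.log u‖ ≤ |Real.log a| + Real.log C + π + 4 * (1 + s ^ 2) ^ (1 / 4 : ℝ) := by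
  have hu0 : 0 < ‖u‖ := ha.trans_le hau
  have hs : (1 : ℝ) ≤ 1 + s ^ 2 := by nlinarith
  have h1 : ‖Complex.log u‖ ≤ |Real.log ‖u‖| + π := by
    refine (Complex.norm_le_abs_re_add_abs_im _).trans ?_
    rw [Complex.log_re, Complex.log_im]
    gcongr
    exact Complex.abs_arg_le_pi u
  have h2 : Real.log a ≤ Real.log ‖u‖ := Real.log_le_log ha hau
  have h3 : 2 * Real.log ‖u‖ ≤ Real.log C + Real.log (1 + s ^ 2) := by
    rw [← Real.log_mul (by positivity) (by positivity)]
    refine le_trans (le_of_eq ?_) (Real.log_le_log (by positivity) hu)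
    rw [Real.log_pow]; norm_num
  have h4 : Real.log (1 + s ^ 2) ≤ (1 + s ^ 2) ^ (1 / 4 : ℝ) / (1 / 4) :=
    Real.log_le_rpow_div (by positivity) (by norm_num)
  have h5 : 0 ≤ Real.log C := Real.log_nonneg hC
  have h6 : 0 ≤ Real.log (1 + s ^ 2) := Real.log_nonneg hs
  have h7 : |Real.log ‖u‖| ≤ |Real.log a| + Real.log C + 4 * (1 + s ^ 2) ^ (1 / 4 : ℝ) := by
    rw [abs_le]
    constructor
    · linarith [neg_abs_le (Real.log a)]
    · linarith [abs_nonneg (Real.log a)]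
  linarith

lemma integrable_const_add_rpow_div_one_add_sq (K : ℝ) :
    Integrable fun s : ℝ ↦ (K + 4 * (1 + s ^ 2) ^ (1 / 4 : ℝ)) / (1 + s ^ 2) := by
  have h1 : Integrable fun s : ℝ ↦ ((1 : ℝ) + ‖s‖ ^ 2) ^ (-(3 / 2 : ℝ) / 2) :=
    integrable_rpow_neg_one_add_norm_sq (by norm_num)
  refine ((integrable_inv_one_add_sq.const_mul K).add (h1.const_mul 4)).congr
    (Eventually.of_forall fun s ↦ ?_)
  have hs : (0 : ℝ) < 1 + s ^ 2 := by positivity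
  have h2 : (1 + s ^ 2) ^ (-(3 / 2 : ℝ) / 2) = (1 + s ^ 2) ^ (1 / 4 : ℝ) / (1 + s ^ 2) := by
    rw [← Real.rpow_sub_one hs.ne']; norm_num
  simp only [Pi.add_apply, Real.norm_eq_abs, sq_abs]
  rw [h2]
  field_simp

lemma norm_div_one_add_sq (x : ℂ) (s : ℝ) : ‖x / (1 + (s : ℂ) ^ 2)‖ = ‖x‖ / (1 + s ^ 2) := by
  rw [norm_div]
  congr 1
  rw [← Complex.ofReal_pow, ← Complex.ofReal_one, ← Complex.ofReal_add, Complex.norm_real,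
    Real.norm_of_nonneg (by positivity)]

lemma one_add_ofReal_sq_ne_zero (s : ℝ) : (1 + (s : ℂ) ^ 2) ≠ 0 := by
  have : (1 + s ^ 2 : ℝ) ≠ 0 := by positivity
  exact_mod_cast this

lemma integrable_log_add_mul_div_one_add_sq {w c : ℂ} {a : ℝ} (ha : 0 < a)
    (h : ∀ s : ℝ, a ≤ ‖w + s * c‖) :
    Integrable fun s : ℝ ↦ Complex.log (w + s * c) / (1 + (s : ℂ) ^ 2) := by
  refine (integrable_const_add_rpow_div_one_add_sq
    (|Real.log a| + Real.log (‖w‖ ^ 2 + ‖c‖ ^ 2 + 1) + π)).mono' ?_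
    (Eventually.of_forall fun s ↦ ?_)
  · exact Measurable.aestronglyMeasurable (by fun_prop)
  · rw [norm_div_one_add_sq]
    gcongr
    refine norm_log_le_of_sq_le ha (h s) (by nlinarith [sq_nonneg ‖w‖, sq_nonneg ‖c‖]) ?_
    have h1 : ‖w + s * c‖ ≤ ‖w‖ + |s| * ‖c‖ := by
      simpa [norm_mul] using norm_add_le w (s * c)
    calc ‖w + s * c‖ ^ 2 ≤ (‖w‖ + |s| * ‖c‖) ^ 2 := by gcongr
      _ ≤ (‖w‖ ^ 2 + ‖c‖ ^ 2 + 1) * (1 + |s| ^ 2) := by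
        nlinarith [sq_nonneg (|s| * ‖w‖ - ‖c‖), sq_nonneg |s|]
      _ = _ := by rw [sq_abs]

lemma re_le_norm_add_mul_I (w : ℂ) (s : ℝ) : w.re ≤ ‖w + s * I‖ := by
  simpa using Complex.re_le_norm (w + s * I)

lemma re_le_norm_sub_mul_I (w : ℂ) (s : ℝ) : w.re ≤ ‖w - s * I‖ := by
  simpa using Complex.re_le_norm (w - s * I)

lemma add_mul_I_mem_slitPlane {w : ℂ} (hw : 0 < w.re) (s : ℝ) : w + s * I ∈ slitPlane :=
  Or.inl (by simpa)

lemma sub_mul_I_mem_slitPlane {w : ℂ} (hw : 0 < w.re) (s : ℝ) : w - s * I ∈ slitPlane :=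
  Or.inl (by simpa)

lemma integrable_log_add_log_div_one_add_sq {w : ℂ} (hw : 0 < w.re) :
    Integrable fun s : ℝ ↦
      (Complex.log (w + s * I) + Complex.log (w - s * I)) / (1 + (s : ℂ) ^ 2) := by
  have h1 := integrable_log_add_mul_div_one_add_sq hw (re_le_norm_add_mul_I w)
  have h2 := integrable_log_add_mul_div_one_add_sq (c := -I) hw fun s ↦ by
    simpa [sub_eq_add_neg] using re_le_norm_sub_mul_I w s
  refine (h1.add h2).congr (Eventually.of_forall fun s ↦ ?_)
  simp [sub_eq_add_neg, add_div]

lemma norm_inv_add_inv_le {w : ℂ} {r : ℝ} (hr : 0 < r) (hw : r ≤ w.re) (s : ℝ) :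
    ‖(w + s * I)⁻¹ + (w - s * I)⁻¹‖ ≤ 2 * r⁻¹ := by
  have h1 : ‖(w + s * I)⁻¹‖ ≤ r⁻¹ := by
    rw [norm_inv]; exact inv_anti₀ hr (hw.trans (re_le_norm_add_mul_I w s))
  have h2 : ‖(w - s * I)⁻¹‖ ≤ r⁻¹ := by
    rw [norm_inv]; exact inv_anti₀ hr (hw.trans (re_le_norm_sub_mul_I w s))
  linarith [norm_add_le (w + s * I)⁻¹ (w - s * I)⁻¹]

lemma integrable_inv_add_inv_div_one_add_sq {w : ℂ} (hw : 0 < w.re) :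
    Integrable fun s : ℝ ↦ ((w + s * I)⁻¹ + (w - s * I)⁻¹) / (1 + (s : ℂ) ^ 2) := by
  refine (integrable_inv_one_add_sq.const_mul (2 * w.re⁻¹)).mono' ?_
    (Eventually.of_forall fun s ↦ ?_)
  · exact Measurable.aestronglyMeasurable (by fun_prop)
  · rw [norm_div_one_add_sq, div_eq_mul_inv]
    gcongr
    exact norm_inv_add_inv_le hw le_rfl s

lemma hasDerivAt_integral_log_add_log {w : ℂ} (hw : 0 < w.re) :
    HasDerivAt (fun w : ℂ ↦ ∫ s in Iio (0 : ℝ),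
        (Complex.log (w + s * I) + Complex.log (w - s * I)) / (1 + (s : ℂ) ^ 2))
      (∫ s in Iio (0 : ℝ), ((w + s * I)⁻¹ + (w - s * I)⁻¹) / (1 + (s : ℂ) ^ 2)) w := by
  have hopen : {x : ℂ | w.re / 2 < x.re} ∈ 𝓝 w :=
    (isOpen_lt continuous_const Complex.continuous_re).mem_nhds (half_lt_self hw)
  refine (hasDerivAt_integral_of_dominated_loc_of_deriv_le (μ := volume.restrict (Iio 0))
    (F := fun w (s : ℝ) ↦
      (Complex.log (w + s * I) + Complex.log (w - s * I)) / (1 + (s : ℂ) ^ 2))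
    (F' := fun w (s : ℝ) ↦ ((w + s * I)⁻¹ + (w - s * I)⁻¹) / (1 + (s : ℂ) ^ 2))
    (bound := fun s ↦ 2 * (w.re / 2)⁻¹ * (1 + s ^ 2)⁻¹) hopen
    (Eventually.of_forall fun x ↦ Measurable.aestronglyMeasurable (by fun_prop))
    (integrable_log_add_log_div_one_add_sq hw).integrableOn
    (Measurable.aestronglyMeasurable (by fun_prop))
    (Eventually.of_forall fun s x hx ↦ ?_)
    (integrable_inv_one_add_sq.const_mul _).integrableOn
    (Eventually.of_forall fun s x hx ↦ ?_)).2
  · rw [norm_div_one_add_sq, div_eq_mul_inv]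
    gcongr
    exact norm_inv_add_inv_le (half_pos hw) (le_of_lt hx) s
  · have hx' : 0 < x.re := (half_pos hw).trans hx
    have h1 := ((hasDerivAt_id x).add_const ((s : ℂ) * I)).clog (add_mul_I_mem_slitPlane hx' s)
    have h2 := ((hasDerivAt_id x).sub_const ((s : ℂ) * I)).clog (sub_mul_I_mem_slitPlane hx' s)
    simpa using (h1.add h2).div_const (1 + (s : ℂ) ^ 2)

lemma hasDerivAt_log_sub_log {w : ℂ} (hw : 0 < w.re) (s : ℝ) :
    HasDerivAt (fun s : ℝ ↦ -I * (Complex.log (w + s * I) - Complex.log (w - s * I)))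
      ((w + s * I)⁻¹ + (w - s * I)⁻¹) s := by
  have h0 : HasDerivAt (fun s : ℝ ↦ (s : ℂ) * I) (1 * I) s :=
    (Complex.ofRealCLM.hasDerivAt (x := s)).mul_const I
  have h1 := (h0.const_add w).clog_real (add_mul_I_mem_slitPlane hw s)
  have h2 := (h0.const_sub w).clog_real (sub_mul_I_mem_slitPlane hw s)
  refine ((h1.sub h2).const_mul (-I)).congr_deriv ?_
  linear_combination (-(w + s * I)⁻¹ - (w - s * I)⁻¹) * I_sq

lemma tendsto_log_sub_log_atBot {w : ℂ} (hw : 0 < w.re) :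
    Tendsto (fun s : ℝ ↦ -I * (Complex.log (w + s * I) - Complex.log (w - s * I))) atBot
      (𝓝 (-π)) := by
  have h0 : Tendsto (fun s : ℝ ↦ w * (((-s)⁻¹ : ℝ) : ℂ)) atBot (𝓝 0) := by
    have : Tendsto (fun s : ℝ ↦ (((-s)⁻¹ : ℝ) : ℂ)) atBot (𝓝 ((0 : ℝ) : ℂ)) :=
      (Complex.continuous_ofReal.tendsto 0).comp
        (tendsto_inv_atTop_zero.comp tendsto_neg_atBot_atTop)
    simpa using this.const_mul w
  have h1 := (h0.add_const (-I)).clog (by simp [mem_slitPlane_iff])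
  have h2 := (h0.add_const I).clog (by simp [mem_slitPlane_iff])
  have h3 := (h1.sub h2).const_mul (-I)
  have h4 : -I * (Complex.log (0 + -I) - Complex.log (0 + I)) = -π := by
    rw [zero_add, zero_add, Complex.log_I, Complex.log_neg_I]
    linear_combination (π : ℂ) * I_sq
  rw [h4] at h3
  refine h3.congr' ?_
  filter_upwards [eventually_lt_atBot (0 : ℝ)] with s hs
  have hs' : 0 < -s := by linarith
  have hs0 : (s : ℂ) ≠ 0 := by exact_mod_cast hs.ne
  have e1 : w + s * I = ((-s : ℝ) : ℂ) * (w * (((-s)⁻¹ : ℝ) : ℂ) + -I) := by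
    push_cast; field_simp; ring
  have e2 : w - s * I = ((-s : ℝ) : ℂ) * (w * (((-s)⁻¹ : ℝ) : ℂ) + I) := by
    push_cast; field_simp; ring
  have n1 := slitPlane_ne_zero (add_mul_I_mem_slitPlane hw s)
  have n2 := slitPlane_ne_zero (sub_mul_I_mem_slitPlane hw s)
  rw [e1] at n1
  rw [e2] at n2
  rw [e1, e2, Complex.log_ofReal_mul hs' (right_ne_zero_of_mul n1),
    Complex.log_ofReal_mul hs' (right_ne_zero_of_mul n2)]
  ring

lemma one_add_sq_eq (s : ℝ) : (1 : ℂ) + (s : ℂ) ^ 2 = (1 + s * I) * (1 - s * I) := by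
  linear_combination (s : ℂ) ^ 2 * I_sq

lemma tendsto_div_one_add_sq_atBot :
    Tendsto (fun s : ℝ ↦ (s : ℂ) / (1 + (s : ℂ) ^ 2)) atBot (𝓝 0) := by
  refine squeeze_zero_norm' (a := fun s : ℝ ↦ (-s)⁻¹) ?_
    (tendsto_inv_atTop_zero.comp tendsto_neg_atBot_atTop)
  filter_upwards [eventually_lt_atBot (0 : ℝ)] with s hs
  rw [norm_div_one_add_sq, Complex.norm_real, Real.norm_of_nonpos hs.le, inv_eq_one_div,
    div_le_div_iff₀ (by positivity) (by linarith)]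
  nlinarith

lemma integral_inv_add_inv_div_one_add_sq {w : ℂ} (hw : 0 < w.re) :
    ∫ s in Iio (0 : ℝ), ((w + s * I)⁻¹ + (w - s * I)⁻¹) / (1 + (s : ℂ) ^ 2) = π / (1 + w) := by
  have h1w : 1 + w ≠ 0 := fun h ↦ by
    have := congrArg Complex.re h
    simp at this
    linarith
  have hone : 0 < (1 : ℂ).re := by simp
  rw [← integral_Iic_eq_integral_Iio]
  by_cases hw1 : w = 1
  · subst hw1
    have hd : ∀ s ∈ Iic (0 : ℝ), HasDerivAt (fun s : ℝ ↦ (s : ℂ) / (1 + (s : ℂ) ^ 2) +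
        (1 / 2) * (-I * (Complex.log (1 + s * I) - Complex.log (1 - s * I))))
        (((1 + s * I)⁻¹ + (1 - s * I)⁻¹) / (1 + (s : ℂ) ^ 2)) s := by
      intro s _
      have h0 : HasDerivAt (fun s : ℝ ↦ (s : ℂ)) 1 s := Complex.ofRealCLM.hasDerivAt
      have h1 := (h0.div ((h0.pow 2).const_add 1) (one_add_ofReal_sq_ne_zero s)).add
        ((hasDerivAt_log_sub_log hone s).const_mul (1 / 2))
      refine h1.congr_deriv ?_
      have n1 := slitPlane_ne_zero (add_mul_I_mem_slitPlane hone s)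
      have n2 := slitPlane_ne_zero (sub_mul_I_mem_slitPlane hone s)
      have n3 := one_add_ofReal_sq_ne_zero s
      have e : (1 + s * I)⁻¹ + (1 - s * I)⁻¹ = 2 / (1 + (s : ℂ) ^ 2) := by
        rw [one_add_sq_eq]; field_simp; ring
      rw [e]
      simp only [Pi.pow_apply]
      field_simp
      norm_num
      ring
    have hl := tendsto_div_one_add_sq_atBot.add ((tendsto_log_sub_log_atBot hone).const_mul (1 / 2))
    rw [integral_Iic_of_hasDerivAt_of_tendsto' hd
      (integrable_inv_add_inv_div_one_add_sq hone).integrableOn hl]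
    simp
    ring
  · have hw2 : w ^ 2 - 1 ≠ 0 := by
      rw [show w ^ 2 - 1 = (w - 1) * (1 + w) by ring]
      exact mul_ne_zero (sub_ne_zero.2 hw1) h1w
    have hd : ∀ s ∈ Iic (0 : ℝ), HasDerivAt (fun s : ℝ ↦
        (w * (-I * (Complex.log (1 + s * I) - Complex.log (1 - s * I))) -
          -I * (Complex.log (w + s * I) - Complex.log (w - s * I))) / (w ^ 2 - 1))
        (((w + s * I)⁻¹ + (w - s * I)⁻¹) / (1 + (s : ℂ) ^ 2)) s := by
      intro s _
      refine ((((hasDerivAt_log_sub_log hone s).const_mul w).sub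
        (hasDerivAt_log_sub_log hw s)).div_const _).congr_deriv ?_
      have n1 := slitPlane_ne_zero (add_mul_I_mem_slitPlane hone s)
      have n2 := slitPlane_ne_zero (sub_mul_I_mem_slitPlane hone s)
      have n3 := slitPlane_ne_zero (add_mul_I_mem_slitPlane hw s)
      have n4 := slitPlane_ne_zero (sub_mul_I_mem_slitPlane hw s)
      rw [one_add_sq_eq]
      field_simp
      ring
    have hl := (((tendsto_log_sub_log_atBot hone).const_mul w).sub
      (tendsto_log_sub_log_atBot hw)).div_const (w ^ 2 - 1)
    rw [integral_Iic_of_hasDerivAt_of_tendsto' hd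
      (integrable_inv_add_inv_div_one_add_sq hw).integrableOn hl]
    simp
    field_simp
    ring

lemma integral_Iio_inv_one_add_sq_complex :
    ∫ s in Iio (0 : ℝ), (1 : ℂ) / (1 + (s : ℂ) ^ 2) = (π : ℂ) / 2 := by
  have h := integral_Iic_inv_one_add_sq (i := 0)
  rw [integral_Iic_eq_integral_Iio] at h
  have h' := congrArg (fun x : ℝ ↦ (x : ℂ)) h
  simp only [Real.arctan_zero, zero_add] at h'
  rw [← integral_complex_ofReal] at h'
  simpa using h'

lemma tendsto_integral_log_one_add_div :
    Tendsto (fun t : ℝ ↦ ∫ s in Iio (0 : ℝ),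
      (Complex.log (1 + (s / t : ℝ) * I) + Complex.log (1 - (s / t : ℝ) * I)) /
        (1 + (s : ℂ) ^ 2)) atTop (𝓝 0) := by
  have hone : 0 < (1 : ℂ).re := by simp
  have key : ∀ u : ℂ, ∀ s t : ℝ, 1 ≤ t → 1 ≤ ‖u‖ → ‖u‖ ^ 2 = 1 + (s / t) ^ 2 →
      ‖Complex.log u‖ ≤ π + 4 * (1 + s ^ 2) ^ (1 / 4 : ℝ) := by
    intro u s t ht h1 h2
    have hst : (s / t) ^ 2 ≤ s ^ 2 := by
      rw [div_pow]
      exact div_le_self (sq_nonneg s) (one_le_pow₀ ht)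
    simpa using norm_log_le_of_sq_le (s := s) one_pos h1 le_rfl (by linarith)
  have h := tendsto_integral_filter_of_dominated_convergence
    (μ := volume.restrict (Iio (0 : ℝ))) (l := atTop) (F := fun (t s : ℝ) ↦
      (Complex.log (1 + (s / t : ℝ) * I) + Complex.log (1 - (s / t : ℝ) * I)) /
        (1 + (s : ℂ) ^ 2)) (f := fun _ ↦ 0)
    (fun s ↦ 2 * ((π + 4 * (1 + s ^ 2) ^ (1 / 4 : ℝ)) / (1 + s ^ 2)))
    (Eventually.of_forall fun t ↦ Measurable.aestronglyMeasurable (by fun_prop))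
    ?_ ((integrable_const_add_rpow_div_one_add_sq π).const_mul 2).integrableOn
    (Eventually.of_forall fun s ↦ ?_)
  · simpa using h
  · filter_upwards [eventually_ge_atTop (1 : ℝ)] with t ht
    refine Eventually.of_forall fun s ↦ ?_
    rw [norm_div_one_add_sq, ← mul_div_assoc]
    gcongr
    have h1 := key (1 + (s / t : ℝ) * I) s t ht (by simpa using re_le_norm_add_mul_I 1 (s / t))
      (by rw [← Complex.normSq_eq_norm_sq, Complex.normSq_apply]; simp; ring)
    have h2 := key (1 - (s / t : ℝ) * I) s t ht (by simpa using re_le_norm_sub_mul_I 1 (s / t))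
      (by rw [← Complex.normSq_eq_norm_sq, Complex.normSq_apply]; simp; ring)
    linarith [norm_add_le (Complex.log (1 + (s / t : ℝ) * I)) (Complex.log (1 - (s / t : ℝ) * I))]
  · have h0 : Tendsto (fun t : ℝ ↦ ((s / t : ℝ) : ℂ) * I) atTop (𝓝 0) := by
      have : Tendsto (fun t : ℝ ↦ ((s / t : ℝ) : ℂ)) atTop (𝓝 ((0 : ℝ) : ℂ)) :=
        (Complex.continuous_ofReal.tendsto 0).comp (tendsto_id.const_div_atTop s)
      simpa using this.mul_const I
    have h1 := (h0.const_add 1).clog (by simp)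
    have h2 := (h0.const_sub 1).clog (by simp)
    simpa using (h1.add h2).div_const (1 + (s : ℂ) ^ 2)

lemma integral_log_add_log_ofReal {t : ℝ} (ht : 0 < t) :
    ∫ s in Iio (0 : ℝ),
      (Complex.log (t + s * I) + Complex.log (t - s * I)) / (1 + (s : ℂ) ^ 2) =
    (π : ℂ) * Real.log t + ∫ s in Iio (0 : ℝ),
      (Complex.log (1 + (s / t : ℝ) * I) + Complex.log (1 - (s / t : ℝ) * I)) /
        (1 + (s : ℂ) ^ 2) := by
  have hone : 0 < (1 : ℂ).re := by simp
  have ht0 : (t : ℂ) ≠ 0 := by exact_mod_cast ht.ne'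
  have e : ∀ s : ℝ, (Complex.log (t + s * I) + Complex.log (t - s * I)) / (1 + (s : ℂ) ^ 2) -
      2 * Real.log t * (1 / (1 + (s : ℂ) ^ 2)) =
      (Complex.log (1 + (s / t : ℝ) * I) + Complex.log (1 - (s / t : ℝ) * I)) /
        (1 + (s : ℂ) ^ 2) := by
    intro s
    have e1 : (t : ℂ) + s * I = t * (1 + (s / t : ℝ) * I) := by push_cast; field_simp
    have e2 : (t : ℂ) - s * I = t * (1 - (s / t : ℝ) * I) := by push_cast; field_simp
    rw [e1, e2, Complex.log_ofReal_mul ht (slitPlane_ne_zero (add_mul_I_mem_slitPlane hone _)),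
      Complex.log_ofReal_mul ht (slitPlane_ne_zero (sub_mul_I_mem_slitPlane hone _))]
    ring
  have hinv : Integrable fun s : ℝ ↦ (1 : ℂ) / (1 + (s : ℂ) ^ 2) := by
    simpa using integrable_inv_one_add_sq.ofReal (𝕜 := ℂ)
  simp_rw [← e]
  rw [integral_sub (integrable_log_add_log_div_one_add_sq (by simpa)).integrableOn
    (hinv.const_mul _).integrableOn, integral_const_mul, integral_Iio_inv_one_add_sq_complex]
  ring

lemma integral_log_add_log {w : ℂ} (hw : 0 < w.re) :
    ∫ s in Iio (0 : ℝ),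
      (Complex.log (w + s * I) + Complex.log (w - s * I)) / (1 + (s : ℂ) ^ 2) =
    π * Complex.log (1 + w) := by
  set G : ℂ → ℂ := fun w ↦ ∫ s in Iio (0 : ℝ),
      (Complex.log (w + s * I) + Complex.log (w - s * I)) / (1 + (s : ℂ) ^ 2) with hG
  have hd : ∀ x ∈ {x : ℂ | 0 < x.re}, HasDerivAt (fun x ↦ G x - π * Complex.log (1 + x)) 0 x := by
    intro x hx
    have h1 := hasDerivAt_integral_log_add_log hx
    rw [integral_inv_add_inv_div_one_add_sq hx] at h1
    have h2 := ((hasDerivAt_id x).const_add 1).clog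
      (Or.inl (by simpa using add_pos one_pos hx))
    refine (h1.sub (h2.const_mul (π : ℂ))).congr_deriv ?_
    simp only [id]
    ring
  obtain ⟨c, hc⟩ := (isOpen_lt continuous_const
    Complex.continuous_re).exists_is_const_of_deriv_eq_zero
    (convex_halfSpace_re_gt 0).isPreconnected
    (fun x hx ↦ (hd x hx).differentiableAt.differentiableWithinAt) (fun x hx ↦ (hd x hx).deriv)
  have hlim : Tendsto (fun t : ℝ ↦ G t - π * Complex.log (1 + t)) atTop (𝓝 0) := by
    have h1 : Tendsto (fun t : ℝ ↦ Complex.log (1 + (t⁻¹ : ℝ))) atTop (𝓝 0) := by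
      have : Tendsto (fun t : ℝ ↦ ((t⁻¹ : ℝ) : ℂ)) atTop (𝓝 ((0 : ℝ) : ℂ)) :=
        (Complex.continuous_ofReal.tendsto 0).comp tendsto_inv_atTop_zero
      simpa using (this.const_add 1).clog (by simp)
    have h2 := tendsto_integral_log_one_add_div.sub (h1.const_mul (π : ℂ))
    simp only [mul_zero, sub_zero] at h2
    refine h2.congr' ?_
    filter_upwards [eventually_gt_atTop (0 : ℝ)] with t ht
    have ht0 : (t : ℂ) ≠ 0 := by exact_mod_cast ht.ne'
    have e : (1 : ℂ) + t = t * (1 + (t⁻¹ : ℝ)) := by push_cast; field_simp; ring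
    have n : (1 : ℂ) + (t⁻¹ : ℝ) ≠ 0 := by
      have : 1 + t⁻¹ ≠ 0 := by positivity
      exact_mod_cast this
    rw [hG, e, Complex.log_ofReal_mul ht n]
    simp only [integral_log_add_log_ofReal ht]
    ring
  have hc0 : c = 0 := by
    refine tendsto_nhds_unique (tendsto_const_nhds.congr' ?_) hlim
    filter_upwards [eventually_gt_atTop (0 : ℝ)] with t ht
    exact (hc t (by simpa using ht)).symm
  exact sub_eq_zero.1 ((hc w hw).trans hc0)

lemma log_I_mul_add_log_neg_I_mul {u v : ℂ} (hu : 0 < u.re) (hv : 0 < v.re) :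
    Complex.log (I * u) + Complex.log (-I * v) = Complex.log u + Complex.log v := by
  have hu0 : u ≠ 0 := fun h ↦ by simp [h] at hu
  have hv0 : v ≠ 0 := fun h ↦ by simp [h] at hv
  have hau := abs_lt.1 (Complex.abs_arg_lt_pi_div_two_iff.2 (Or.inl hu))
  have hav := abs_lt.1 (Complex.abs_arg_lt_pi_div_two_iff.2 (Or.inl hv))
  rw [(Complex.log_mul_eq_add_log_iff I_ne_zero hu0).2
      (by rw [Complex.arg_I]; constructor <;> linarith),
    (Complex.log_mul_eq_add_log_iff (neg_ne_zero.2 I_ne_zero) hv0).2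
      (by rw [Complex.arg_neg_I]; constructor <;> linarith), Complex.log_I, Complex.log_neg_I]
  ring

theorem Bfun_add_Bfun_neg (z : ℂ) (hz : 0 < z.im) :
    Bfun z + Bfun (-z) = Complex.log (1 - Complex.I * z) := by
  have hw : 0 < (-(I * z)).re := by simpa
  have hpos := integrable_log_add_mul_div_one_add_sq (w := z) (c := -1) hz fun s ↦ by
    simpa using Complex.im_le_norm (z + s * -1)
  have hneg := integrable_log_add_mul_div_one_add_sq (w := -z) (c := -1) hz fun s ↦ by
    simpa using (neg_le_abs _).trans (Complex.abs_im_le_norm (-z + s * -1))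
  simp only [mul_neg_one, ← sub_eq_add_neg] at hpos hneg
  have h := integral_log_add_log hw
  rw [← sub_eq_add_neg] at h
  rw [Bfun, Bfun, ← mul_add, ← integral_add hpos.integrableOn hneg.integrableOn]
  have e : ∀ s : ℝ, Complex.log (z - s) / (1 + (s : ℂ) ^ 2) +
      Complex.log (-z - s) / (1 + (s : ℂ) ^ 2) =
      (Complex.log (-(I * z) + s * I) + Complex.log (-(I * z) - s * I)) / (1 + (s : ℂ) ^ 2) := by
    intro s
    rw [← add_div, ← log_I_mul_add_log_neg_I_mul (u := -(I * z) + s * I) (v := -(I * z) - s * I)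
      (by simpa) (by simpa)]
    congr 3
    · linear_combination (z - s) * I_sq
    · linear_combination (-z - s) * I_sq
  simp_rw [e]
  rw [h]
  have : (π : ℂ) ≠ 0 := by exact_mod_cast Real.pi_ne_zero
  field_simp
end
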